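/- Every probabilistic recursive function is computable by a probabilistic Turing machine: PR ⊆ PC (modulo a fixed computable bijection between ℕ and Σ*). -/

import Mathlib

noncomputable section
open scoped Classical

/-- A pseudodistribution on ℕ: pointwise nonnegative, summable, with total mass at most 1. -/
def IsPseudoDist (D : ℕ → ℝ) : Prop :=
  (∀ n, 0 ≤ D n) ∧ Summable D ∧ ∑' n, D n ≤ 1

/-- Generalized composition:
(f ⊙ (g₁,…,gₙ))(x⃗)(y) = ∑_{z⃗} f(z⃗)(y) · ∏ᵢ gᵢ(x⃗)(zᵢ). -/
noncomputable def genComp {n k : ℕ} (f : (Fin n → ℕ) → ℕ → ℝ)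
    (g : Fin n → (Fin k → ℕ) → ℕ → ℝ) : (Fin k → ℕ) → ℕ → ℝ :=
  fun x y => ∑' z : Fin n → ℕ, f z y * ∏ i, g i x (z i)

/-- Auxiliary for primitive recursion: h(x⃗,0) = f(x⃗),
h(x⃗,y+1)(w) = ∑_z g(x⃗,y,z)(w) · h(x⃗,y)(z). -/
noncomputable def primRecAux {k : ℕ} (f : (Fin k → ℕ) → ℕ → ℝ)
    (g : (Fin (k + 2) → ℕ) → ℕ → ℝ) (x : Fin k → ℕ) : ℕ → ℕ → ℝ
  | 0 => f x
  | y + 1 => fun w =>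
      ∑' z : ℕ, g (Fin.snoc (Fin.snoc x y) z) w * primRecAux f g x y z

/-- Primitive recursion of probabilistic functions, as a function on ℕ^(k+1). -/
noncomputable def primRec {k : ℕ} (f : (Fin k → ℕ) → ℕ → ℝ)
    (g : (Fin (k + 2) → ℕ) → ℕ → ℝ) : (Fin (k + 1) → ℕ) → ℕ → ℝ :=
  fun v => primRecAux f g (Fin.init v) (v (Fin.last k))

/-- Minimization: (μf)(x⃗)(y) = f(x⃗,y)(0) · ∏_{z<y} (∑_{k>0} f(x⃗,z)(k)). -/
noncomputable def minimize {k : ℕ} (f : (Fin (k + 1) → ℕ) → ℕ → ℝ) :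
    (Fin k → ℕ) → ℕ → ℝ :=
  fun x y =>
    f (Fin.snoc x y) 0 *
      ∏ z ∈ Finset.range y, ∑' m : {m : ℕ // 0 < m}, f (Fin.snoc x z) (m : ℕ)

/-- The class PR of probabilistic recursive functions: the smallest class of
probabilistic functions containing the basic probabilistic functions (zero,
successor, projections, fair coin) and closed under generalized composition,
primitive recursion and minimization. -/
inductive PR : {k : ℕ} → ((Fin k → ℕ) → ℕ → ℝ) → Prop where
  /-- The zero function z(n) = Dirac(0). -/
  | zero : PR (fun (_ : Fin 1 → ℕ) (y : ℕ) => if y = 0 then (1 : ℝ) else 0)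
  /-- The successor function s(n) = Dirac(n+1). -/
  | succ : PR (fun (x : Fin 1 → ℕ) (y : ℕ) => if y = x 0 + 1 then (1 : ℝ) else 0)
  /-- The projections Πⁿₘ(x⃗) = Dirac(xₘ). -/
  | proj {n : ℕ} (m : Fin n) :
      PR (fun (x : Fin n → ℕ) (y : ℕ) => if y = x m then (1 : ℝ) else 0)
  /-- The fair coin r(x), assigning probability 1/2 to each of x and x+1. -/
  | coin : PR (fun (x : Fin 1 → ℕ) (y : ℕ) =>
      if y = x 0 ∨ y = x 0 + 1 then (1 : ℝ) / 2 else 0)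
  /-- Closure under generalized composition. -/
  | comp {n k : ℕ} {f : (Fin n → ℕ) → ℕ → ℝ} {g : Fin n → (Fin k → ℕ) → ℕ → ℝ} :
      PR f → (∀ i, PR (g i)) → PR (genComp f g)
  /-- Closure under primitive recursion. -/
  | primrec {k : ℕ} {f : (Fin k → ℕ) → ℕ → ℝ} {g : (Fin (k + 2) → ℕ) → ℕ → ℝ} :
      PR f → PR g → PR (primRec f g)
  /-- Closure under minimization. -/
  | minim {k : ℕ} {f : (Fin (k + 1) → ℕ) → ℕ → ℝ} :
      PR f → PR (minimize f)

/-- Head moves of a Turing machine. -/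
inductive Move where
  | left : Move
  | right : Move

/-- A probabilistic Turing machine over the alphabet A (tape alphabet
`Option A`, where `none` is the blank symbol): a finite set of states with an
initial state and a set of final states, and two transition functions δ₀, δ₁,
each applied with probability 1/2 at each step. A transition reads the current
state and scanned symbol and yields a new state, a symbol to write, and a head
move. -/
structure PTM (A : Type) where
  /-- The set of states. -/
  Q : Type
  /-- The set of states is finite. -/
  [finQ : Fintype Q]
  /-- The initial state. -/
  init : Q
  /-- The final states. -/
  final : Set Q
  /-- The first transition function. -/
  δ₀ : Q → Option A → Q × Option A × Move
  /-- The second transition function. -/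
  δ₁ : Q → Option A → Q × Option A × Move

/-- A configuration of a PTM: tape to the left of the head (nearest symbol
first), scanned symbol, tape to the right of the head, current state. -/
structure Conf {A : Type} (M : PTM A) where
  /-- Tape on the left of the head, nearest symbol first. -/
  left : List (Option A)
  /-- The scanned symbol. -/
  scan : Option A
  /-- Tape on the right of the head. -/
  right : List (Option A)
  /-- The current state. -/
  state : M.Q

/-- A configuration is final when its state is final. -/
def Conf.IsFinal {A : Type} {M : PTM A} (c : Conf M) : Prop := c.state ∈ M.final

/-- Apply a transition function to a configuration: write the symbol, move the
head and change state (fresh blank cells appear at the tape ends when needed). -/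
def applyTrans {A : Type} {M : PTM A}
    (t : M.Q → Option A → M.Q × Option A × Move) (c : Conf M) : Conf M :=
  match t c.state c.scan with
  | (q', b, Move.left) =>
    match c.left with
    | [] => ⟨[], none, b :: c.right, q'⟩
    | x :: l => ⟨l, x, b :: c.right, q'⟩
  | (q', b, Move.right) =>
    match c.right with
    | [] => ⟨b :: c.left, none, [], q'⟩
    | x :: r => ⟨b :: c.left, x, r, q'⟩

/-- The string (over A) written on the tape of a configuration: the tape content
with blanks removed. -/
def outStr {A : Type} {M : PTM A} (c : Conf M) : List A :=
  (c.left.reverse ++ c.scan :: c.right).filterMap id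

/-- The initial configuration for input string s: empty left tape, head on the
first symbol of s, initial state. -/
def initConf {A : Type} (M : PTM A) (s : List A) : Conf M :=
  match s with
  | [] => ⟨[], none, [], M.init⟩
  | a :: v => ⟨[], some a, v.map some, M.init⟩

/-- The one-step functional F_M of the PTM M, acting on functions from
configurations to pseudodistributions on strings: F_M(f)(C) is the Dirac
distribution on the tape string of C if C is final, and
½·f(δ₀(C)) + ½·f(δ₁(C)) otherwise. -/
noncomputable def Fm {A : Type} (M : PTM A)
    (f : Conf M → List A → ℝ) : Conf M → List A → ℝ :=
  fun c s =>
    if c.IsFinal then (if s = outStr c then 1 else 0)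
    else (1 / 2) * f (applyTrans M.δ₀ c) s + (1 / 2) * f (applyTrans M.δ₁ c) s

/-- The least fixpoint of F_M, obtained as the supremum of the ascending chain
of iterates of F_M starting from the everywhere-zero function. -/
noncomputable def lfpFm {A : Type} (M : PTM A) : Conf M → List A → ℝ :=
  fun c s => ⨆ n : ℕ, (Fm M)^[n] (fun _ _ => 0) c s

/-- The probabilistic function IO_M : Σ* → 𝒫(Σ*) computed by the PTM M:
the least fixpoint of F_M evaluated at the initial configuration. -/
noncomputable def IOfun {A : Type} (M : PTM A) : List A → List A → ℝ :=
  fun s => lfpFm M (initConf M s)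

noncomputable instance : Denumerable (List Bool) :=
  Denumerable.ofEncodableOfInfinite (List Bool)

/-- A fixed computable bijection between strings (over the alphabet Bool) and ℕ,
induced by the canonical encoding of List Bool. -/
noncomputable def strNatEquiv : List Bool ≃ ℕ := Denumerable.eqv (List Bool)

/-- PC: the class of (unary) probabilistic functions computed by probabilistic
Turing machines, transported to ℕ along the fixed bijection `strNatEquiv`. -/
def PCfun (f : (Fin 1 → ℕ) → ℕ → ℝ) : Prop :=
  ∃ M : PTM Bool, ∀ (x : Fin 1 → ℕ) (y : ℕ),
    f x y = IOfun M (strNatEquiv.symm (x 0)) (strNatEquiv.symm y)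

/-! ### Samplers reading coin flips from a list -/

/-- A sampler consumes a prefix of a list of coin flips and returns a value together with the
unused flips, or fails when there are not enough of them. -/
abbrev Sampler (β : Type) := List Bool → Option (β × List Bool)

namespace Sampler

variable {β γ : Type}

/-- The result depends only on the consumed prefix. -/
def Good (S : Sampler β) : Prop :=
  ∀ b y r, S b = some (y, r) → ∃ c, b = c ++ r ∧ ∀ r', S (c ++ r') = some (y, r')

/-- The probability that exactly the flips `c` are consumed, with value `y`. -/
def term (S : Sampler β) (y : β) (c : List Bool) : ENNReal :=
  if S c = some (y, []) then 2⁻¹ ^ c.length else 0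

/-- The distribution of the values of a sampler. -/
def den (S : Sampler β) (y : β) : ENNReal := ∑' c, S.term y c

/-- Sequential composition of samplers. -/
def bind (S : Sampler β) (T : β → Sampler γ) : Sampler γ :=
  fun b => (S b).bind fun p => T p.1 p.2

/-- The sampler with a constant value. -/
def pure (a : β) : Sampler β := fun b => some (a, b)

/-- The sampler left after the first coin flip came up `a`. -/
def deriv (S : Sampler β) (a : Bool) : Sampler β := fun b => S (a :: b)

theorem good_pure (a : β) : (pure a).Good := by
  intro b y r h
  simp only [pure, Option.some.injEq, Prod.mk.injEq] at h
  exact ⟨[], by simp [h.2], fun r' => by simp [pure, h.1]⟩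

theorem good_bind {S : Sampler β} {T : β → Sampler γ} (hS : S.Good) (hT : ∀ a, (T a).Good) :
    (S.bind T).Good := by
  intro b y r h
  obtain ⟨⟨a, r₁⟩, h₁, h₂⟩ := Option.bind_eq_some_iff.1 h
  obtain ⟨c₁, rfl, hc₁⟩ := hS _ _ _ h₁
  obtain ⟨c₂, rfl, hc₂⟩ := hT a _ _ _ h₂
  refine ⟨c₁ ++ c₂, by simp, fun r' => ?_⟩
  simp [bind, hc₁, hc₂]

theorem Good.append {S : Sampler β} (hS : S.Good) {c : List Bool} {y : β}
    (h : S c = some (y, [])) (r : List Bool) : S (c ++ r) = some (y, r) := by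
  obtain ⟨c', hc, h'⟩ := hS _ _ _ h
  rw [List.append_nil] at hc
  exact hc ▸ h' r

theorem Good.nil {S : Sampler β} (hS : S.Good) {y : β} {r : List Bool}
    (h : S [] = some (y, r)) : ∀ c, S c = some (y, c) := by
  obtain ⟨c', hc, h'⟩ := hS _ _ _ h
  obtain ⟨rfl, rfl⟩ := List.append_eq_nil_iff.1 hc.symm
  simpa using h'

theorem Good.deriv {S : Sampler β} (hS : S.Good) (h : S [] = none) (a : Bool) :
    (S.deriv a).Good := by
  intro b y r hb
  obtain ⟨c, hc, h'⟩ := hS _ _ _ hb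
  cases c with
  | nil => exact absurd (h' []) (by simp [h])
  | cons x c =>
    obtain ⟨rfl, rfl⟩ : a = x ∧ b = c ++ r := by simpa using hc
    exact ⟨c, rfl, h'⟩

theorem den_pure (a y : β) : (pure a).den y = if y = a then 1 else 0 := by
  rw [den, tsum_eq_single []]
  · simp [term, pure, eq_comm]
  · intro c hc
    simp [term, pure, hc]

theorem den_bind {S : Sampler β} (hS : S.Good) (T : β → Sampler γ) (y : γ) :
    (S.bind T).den y = ∑' a, S.den a * (T a).den y := by
  have key : ∀ a, S.den a * (T a).den y =
      ∑' p : List Bool × List Bool, S.term a p.1 * (T a).term y p.2 := by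
    intro a
    rw [ENNReal.tsum_prod (f := fun c d => S.term a c * (T a).term y d), den,
      ← ENNReal.tsum_mul_right]
    congr 1
    ext c
    rw [den, ENNReal.tsum_mul_left]
  simp_rw [key]
  rw [← ENNReal.tsum_prod (f := fun a (p : List Bool × List Bool) =>
    S.term a p.1 * (T a).term y p.2), den]
  set F : β × List Bool × List Bool → ENNReal :=
    fun q => S.term q.1 q.2.1 * (T q.1).term y q.2.2 with hF
  have hF0 : ∀ q, F q ≠ 0 → S q.2.1 = some (q.1, []) ∧ T q.1 q.2.2 = some (y, []) := by
    intro q hq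
    simp only [hF, term] at hq
    constructor <;> by_contra h <;> simp [h] at hq
  refine tsum_eq_tsum_of_ne_zero_bij (fun q => q.1.2.1 ++ q.1.2.2) ?_ ?_ ?_
  · rintro ⟨⟨a, c, d⟩, h⟩ ⟨⟨a', c', d'⟩, h'⟩ he
    obtain ⟨h1, -⟩ := hF0 _ h
    obtain ⟨h1', -⟩ := hF0 _ h'
    simp only at he h1 h1'
    have e1 := hS.append h1 d
    have e2 := hS.append h1' d'
    rw [he, e2] at e1
    obtain ⟨rfl, rfl⟩ : a' = a ∧ d' = d := by simpa using e1
    simp_all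
  · intro c hc
    have hb : S.bind T c = some (y, []) := by
      by_contra h
      simp [term, h] at hc
    obtain ⟨⟨a, r⟩, h₁, h₂⟩ := Option.bind_eq_some_iff.1 hb
    obtain ⟨c₁, rfl, hc₁⟩ := hS _ _ _ h₁
    have h3 := hc₁ []
    rw [List.append_nil] at h3
    simp only at h₂
    refine ⟨⟨(a, c₁, r), ?_⟩, rfl⟩
    simp only [Function.mem_support, term, h3, h₂, if_true]
    simp
  · rintro ⟨⟨a, c, d⟩, h⟩
    obtain ⟨h1, h2⟩ := hF0 _ h
    simp only at h1 h2
    have : S.bind T (c ++ d) = some (y, []) := by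
      simp [bind, hS.append h1 d, h2]
    simp [term, this, h1, h2, pow_add]

/-- Depth-`n` approximation of the distribution of a sampler. -/
def approx : ℕ → Sampler β → β → ENNReal
  | 0, _, _ => 0
  | n + 1, S, y =>
    match S [] with
    | some (z, _) => if y = z then 1 else 0
    | none => 2⁻¹ * approx n (S.deriv false) y + 2⁻¹ * approx n (S.deriv true) y

theorem approx_le_one (n : ℕ) : ∀ (S : Sampler β) (y : β), approx n S y ≤ 1 := by
  induction n with
  | zero => simp [approx]
  | succ n ih =>
    intro S y
    rw [approx]
    split
    · split <;> simp
    · calc _ ≤ (2⁻¹ * 1 + 2⁻¹ * 1 : ENNReal) := by gcongr <;> exact ih _ _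
        _ = 1 := by rw [mul_one, ENNReal.inv_two_add_inv_two]

theorem tsum_list_bool (f : List Bool → ENNReal) :
    ∑' c, f c = f [] + (∑' c, f (false :: c) + ∑' c, f (true :: c)) := by
  let e : Unit ⊕ (Bool × List Bool) ≃ List Bool :=
    { toFun := fun o => o.elim (fun _ => []) fun p => p.1 :: p.2
      invFun := fun l => match l with
        | [] => Sum.inl ()
        | a :: l => Sum.inr (a, l)
      left_inv := by rintro (_ | ⟨a, l⟩) <;> rfl
      right_inv := by rintro (_ | ⟨a, l⟩) <;> rfl }
  rw [← e.tsum_eq, Summable.tsum_sum ENNReal.summable ENNReal.summable, tsum_fintype]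
  congr 1
  · simp [e]
  · exact (ENNReal.tsum_prod (f := fun a l => f (a :: l))).trans (tsum_bool _)

theorem term_cons (S : Sampler β) (y : β) (a : Bool) (c : List Bool) :
    S.term y (a :: c) = 2⁻¹ * (S.deriv a).term y c := by
  by_cases h : S (a :: c) = some (y, [])
  · have h' : S.deriv a c = some (y, []) := h
    rw [term, term, if_pos h, if_pos h', List.length_cons, pow_succ']
  · have h' : ¬S.deriv a c = some (y, []) := h
    rw [term, term, if_neg h, if_neg h', mul_zero]

theorem Good.den_of_some {S : Sampler β} (hS : S.Good) {z : β} {r : List Bool}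
    (h : S [] = some (z, r)) (y : β) : S.den y = if y = z then 1 else 0 := by
  have : S = pure z := funext (hS.nil h)
  rw [this, den_pure]

theorem den_of_none {S : Sampler β} (h : S [] = none) (y : β) :
    S.den y = 2⁻¹ * (S.deriv false).den y + 2⁻¹ * (S.deriv true).den y := by
  rw [den, tsum_list_bool]
  simp_rw [term_cons, ENNReal.tsum_mul_left]
  simp [term, h, den]

theorem approx_le_den (n : ℕ) : ∀ (S : Sampler β) (_ : S.Good) (y : β), approx n S y ≤ S.den y := by
  induction n with
  | zero => simp [approx]
  | succ n ih =>
    intro S hS y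
    rw [approx]
    split
    · next h => rw [hS.den_of_some h]
    · next h =>
      rw [den_of_none h]
      gcongr <;> exact ih _ (hS.deriv h _) _

theorem sum_term_le_approx (n : ℕ) : ∀ (S : Sampler β) (_ : S.Good) (y : β),
    ∑' c, (if c.length < n then S.term y c else 0) ≤ approx n S y := by
  induction n with
  | zero => simp [approx]
  | succ n ih =>
    intro S hS y
    rw [approx]
    split
    · next h =>
      rw [← hS.den_of_some h]
      refine ENNReal.tsum_le_tsum fun c => ?_
      split <;> simp
    · next h =>
      rw [tsum_list_bool]
      simp only [List.length_cons, Nat.add_lt_add_iff_right, term_cons]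
      simp_rw [← mul_ite_zero, ENNReal.tsum_mul_left]
      have : S.term y [] = 0 := by simp [term, h]
      simp only [this, ite_self, zero_add]
      gcongr <;> exact ih _ (hS.deriv h _) _

theorem den_eq_iSup {S : Sampler β} (hS : S.Good) (y : β) : S.den y = ⨆ n, approx n S y := by
  refine le_antisymm ?_ (iSup_le fun n => approx_le_den n S hS y)
  rw [den, ENNReal.tsum_eq_iSup_sum]
  refine iSup_le fun s => ?_
  refine le_trans ?_ ((sum_term_le_approx (s.sup List.length + 1) S hS y).trans
    (le_iSup (fun n => approx n S y) _))
  refine le_trans (Finset.sum_le_sum fun c hc => ?_) (ENNReal.sum_le_tsum s)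
  rw [if_pos (Nat.lt_succ_of_le (Finset.le_sup (f := List.length) hc))]

theorem den_le_one {S : Sampler β} (hS : S.Good) (y : β) : S.den y ≤ 1 := by
  rw [den_eq_iSup hS]
  exact iSup_le fun n => approx_le_one n S y

theorem den_ne_top {S : Sampler β} (hS : S.Good) (y : β) : S.den y ≠ ⊤ :=
  ne_top_of_le_ne_top ENNReal.one_ne_top (den_le_one hS y)

/-- The sampler returning a coin flip. -/
def flip : Sampler Bool
  | [] => none
  | a :: r => some (a, r)

theorem good_flip : flip.Good := by
  rintro (_ | ⟨a, b⟩) y r h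
  · simp [flip] at h
  · obtain ⟨rfl, rfl⟩ : a = y ∧ b = r := by simpa [flip] using h
    exact ⟨[a], rfl, fun r' => rfl⟩

theorem den_flip (y : Bool) : flip.den y = 2⁻¹ := by
  rw [den_of_none rfl]
  have : ∀ a, flip.deriv a = pure a := fun a => rfl
  rw [this, this, den_pure, den_pure]
  cases y <;> simp

end Sampler

/-! ### Probabilistic recursive functions have primitive recursive samplers -/

namespace Sampler

/-- `S` is a primitive recursive sampler for the probabilistic function `f`. -/
structure Samples {k : ℕ} (S : List ℕ → Sampler ℕ) (f : (Fin k → ℕ) → ℕ → ℝ) : Prop where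
  primrec : Primrec₂ S
  good : ∀ x, (S x).Good
  eq_den : ∀ x y, f x y = ((S (List.ofFn x)).den y).toReal

theorem primrec_bind {α β γ : Type} [Primcodable α] [Primcodable β] [Primcodable γ]
    {S : α → Sampler β} {T : α → β → Sampler γ} (hS : Primrec₂ S)
    (hT : Primrec fun q : (α × β) × List Bool => T q.1.1 q.1.2 q.2) :
    Primrec₂ fun a => (S a).bind (T a) := by
  refine Primrec.option_bind hS ?_
  exact hT.comp (Primrec.pair (Primrec.pair (Primrec.fst.comp Primrec.fst)
    (Primrec.fst.comp Primrec.snd)) (Primrec.snd.comp Primrec.snd))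

theorem samples_pure {k : ℕ} {h : List ℕ → ℕ} (hh : Primrec h) {g : (Fin k → ℕ) → ℕ}
    (hg : ∀ x, h (List.ofFn x) = g x) :
    Samples (fun x => pure (h x)) fun x y => if y = g x then 1 else 0 where
  primrec := Primrec.option_some.comp (Primrec.pair (hh.comp Primrec.fst) Primrec.snd)
  good x := good_pure _
  eq_den x y := by
    rw [den_pure, hg]
    split <;> simp

theorem primrec_flip : Primrec flip := by
  have : Primrec fun l : List Bool => l.head?.map fun a => (a, l.tail) := by
    refine Primrec.option_map Primrec.list_head? ?_
    exact (Primrec.pair Primrec.snd (Primrec.list_tail.comp Primrec.fst))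
  exact this.of_eq fun l => by cases l <;> rfl

theorem samples_coin :
    Samples (fun x => flip.bind fun a => pure (x.headI + a.toNat)) fun (x : Fin 1 → ℕ) y =>
      if y = x 0 ∨ y = x 0 + 1 then 1 / 2 else 0 where
  primrec := by
    refine primrec_bind (primrec_flip.comp Primrec.snd) ?_
    refine Primrec.option_some.comp (Primrec.pair (Primrec.nat_add.comp
      (Primrec.list_headI.comp (Primrec.fst.comp Primrec.fst))
      ((Primrec.dom_bool Bool.toNat).comp (Primrec.snd.comp Primrec.fst))) Primrec.snd)
  good x := good_bind good_flip fun _ => good_pure _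
  eq_den x y := by
    rw [den_bind good_flip, tsum_bool, den_pure, den_pure, den_flip, den_flip]
    have : (List.ofFn x).headI = x 0 := by simp
    rw [this]
    by_cases h1 : y = x 0
    · simp [h1]
    · by_cases h2 : y = x 0 + 1 <;> simp [h1, h2]

/-- Run finitely many samplers in a row and collect the values. -/
def sequence : List (List ℕ → Sampler ℕ) → List ℕ → Sampler (List ℕ)
  | [], _ => pure []
  | S :: Ss, x => (S x).bind fun a => (sequence Ss x).bind fun l => pure (a :: l)

theorem good_sequence {Ss : List (List ℕ → Sampler ℕ)} (h : ∀ S ∈ Ss, ∀ x, (S x).Good)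
    (x : List ℕ) : (sequence Ss x).Good := by
  induction Ss with
  | nil => exact good_pure _
  | cons S Ss ih =>
    exact good_bind (h S (by simp) x) fun a =>
      good_bind (ih fun S hS => h S (by simp [hS])) fun l => good_pure _

theorem primrec_sequence {Ss : List (List ℕ → Sampler ℕ)} (h : ∀ S ∈ Ss, Primrec₂ S) :
    Primrec₂ (sequence Ss) := by
  induction Ss with
  | nil => exact Primrec.option_some.comp (Primrec.pair (Primrec.const _) Primrec.snd)
  | cons S Ss ih =>
    refine primrec_bind (h S (by simp)) ?_
    have h1 : Primrec₂ fun p : List ℕ × ℕ => sequence Ss p.1 :=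
      (ih fun S hS => h S (by simp [hS])).comp (Primrec.fst.comp Primrec.fst) Primrec.snd
    refine primrec_bind (T := fun (p : List ℕ × ℕ) l => pure (p.2 :: l)) h1 ?_
    refine Primrec.option_some.comp (Primrec.pair ?_ Primrec.snd)
    exact Primrec.list_cons.comp (Primrec.snd.comp (Primrec.fst.comp Primrec.fst))
      (Primrec.snd.comp Primrec.fst)

theorem den_sequence_cons {S : List ℕ → Sampler ℕ} {Ss : List (List ℕ → Sampler ℕ)}
    (h : ∀ T ∈ S :: Ss, ∀ x, (T x).Good) (x : List ℕ) (l : List ℕ) :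
    (sequence (S :: Ss) x).den l = match l with
      | [] => 0
      | a :: l => (S x).den a * (sequence Ss x).den l := by
  have hSs : (sequence Ss x).Good := good_sequence (fun T hT => h T (by simp [hT])) x
  rw [sequence, den_bind (h S (by simp) x)]
  have : ∀ a : ℕ, ((sequence Ss x).bind fun l => pure (a :: l)).den l =
      ∑' l', (sequence Ss x).den l' * if l = a :: l' then 1 else 0 := by
    intro a
    rw [den_bind hSs]
    refine tsum_congr fun l' => ?_
    rw [den_pure]
    congr
  simp_rw [this]
  cases l with
  | nil => simp
  | cons a l =>
    simp only [List.cons.injEq]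
    rw [tsum_eq_single a]
    · rw [tsum_eq_single l]
      · simp
      · intro l' hl'
        simp [hl'.symm]
    · intro a' ha'
      simp [ha'.symm]

theorem den_sequence_of_length_ne {Ss : List (List ℕ → Sampler ℕ)}
    (h : ∀ T ∈ Ss, ∀ x, (T x).Good) (x : List ℕ) (l : List ℕ) (hl : l.length ≠ Ss.length) :
    (sequence Ss x).den l = 0 := by
  induction Ss generalizing l with
  | nil =>
    rw [sequence, den_pure, if_neg]
    rintro rfl
    simp at hl
  | cons S Ss ih =>
    rw [den_sequence_cons h]
    cases l with
    | nil => rfl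
    | cons a l =>
      simp only
      rw [ih (fun T hT => h T (by simp [hT])) l (by simpa using hl), mul_zero]

theorem den_sequence_ofFn {n : ℕ} (S : Fin n → List ℕ → Sampler ℕ)
    (h : ∀ i x, (S i x).Good) (x : List ℕ) (z : Fin n → ℕ) :
    (sequence (List.ofFn S) x).den (List.ofFn z) = ∏ i, (S i x).den (z i) := by
  induction n with
  | zero => simp [sequence, den_pure]
  | succ n ih =>
    rw [List.ofFn_succ, den_sequence_cons, List.ofFn_succ, Fin.prod_univ_succ]
    · simp only
      rw [ih (fun i => S i.succ) (fun i => h i.succ)]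
    · rw [← List.ofFn_succ]
      intro T hT
      obtain ⟨i, rfl⟩ := (List.mem_ofFn' _ _).1 hT
      exact h i

theorem samples_comp {n k : ℕ} {f : (Fin n → ℕ) → ℕ → ℝ} {g : Fin n → (Fin k → ℕ) → ℕ → ℝ}
    {S : List ℕ → Sampler ℕ} {T : Fin n → List ℕ → Sampler ℕ} (hS : Samples S f)
    (hT : ∀ i, Samples (T i) (g i)) :
    Samples (fun x => (sequence (List.ofFn T) x).bind S) (genComp f g) := by
  have hgood : ∀ R ∈ List.ofFn T, ∀ x, (R x).Good := by
    intro R hR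
    obtain ⟨i, rfl⟩ := (List.mem_ofFn' _ _).1 hR
    exact (hT i).good
  refine ⟨?_, fun x => good_bind (good_sequence hgood x) hS.good, fun x y => ?_⟩
  · refine primrec_bind (primrec_sequence ?_)
      (hS.primrec.comp (Primrec.snd.comp Primrec.fst) Primrec.snd)
    intro R hR
    obtain ⟨i, rfl⟩ := (List.mem_ofFn' _ _).1 hR
    exact (hT i).primrec
  · rw [den_bind (good_sequence hgood _)]
    have hinj : Function.Injective (List.ofFn : (Fin n → ℕ) → List ℕ) := List.ofFn_injective
    rw [← hinj.tsum_eq, ENNReal.tsum_toReal_eq]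
    · unfold genComp
      refine tsum_congr fun z => ?_
      rw [den_sequence_ofFn _ fun i => (hT i).good, hS.eq_den, ENNReal.toReal_mul,
        ENNReal.toReal_prod, mul_comm]
      simp_rw [(hT _).eq_den]
    · exact fun z => ENNReal.mul_ne_top (den_ne_top (good_sequence hgood _) _)
        (den_ne_top (hS.good _) _)
    · intro l hl
      have : l.length = n := by
        by_contra hne
        refine hl ?_
        change _ * _ = _
        rw [den_sequence_of_length_ne hgood, zero_mul]
        simpa using hne
      subst this
      exact ⟨l.get, List.ofFn_get l⟩

/-- Iterate a sampler, feeding it the previous value. -/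
def iter (S : List ℕ → Sampler ℕ) (T : List ℕ → Sampler ℕ) (x : List ℕ) : ℕ → Sampler ℕ
  | 0 => S x
  | y + 1 => (iter S T x y).bind fun z => T (x ++ [y, z])

theorem good_iter {S T : List ℕ → Sampler ℕ} (hS : ∀ x, (S x).Good) (hT : ∀ x, (T x).Good)
    (x : List ℕ) (y : ℕ) : (iter S T x y).Good := by
  induction y with
  | zero => exact hS x
  | succ y ih => exact good_bind ih fun z => hT _

theorem primrec_iter {S T : List ℕ → Sampler ℕ} (hS : Primrec₂ S) (hT : Primrec₂ T) :
    Primrec fun q : (List ℕ × List Bool) × ℕ => iter S T q.1.1 q.2 q.1.2 := by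
  have : Primrec₂ fun (a : List ℕ × List Bool) (y : ℕ) =>
      (Nat.rec (S a.1 a.2) (fun y r => r.bind fun p => T (a.1 ++ [y, p.1]) p.2) y :
        Option (ℕ × List Bool)) := by
    refine Primrec.nat_rec (f := fun a : List ℕ × List Bool => S a.1 a.2)
      (g := fun a (q : ℕ × Option (ℕ × List Bool)) =>
        q.2.bind fun p => T (a.1 ++ [q.1, p.1]) p.2)
      (hS.comp Primrec.fst Primrec.snd) ?_
    refine Primrec.option_bind (Primrec.snd.comp Primrec.snd) ?_
    refine hT.comp (Primrec.list_append.comp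
      (Primrec.fst.comp (Primrec.fst.comp Primrec.fst)) ?_) (Primrec.snd.comp Primrec.snd)
    exact Primrec.list_cons.comp (Primrec.fst.comp (Primrec.snd.comp Primrec.fst))
      (Primrec.list_cons.comp (Primrec.fst.comp Primrec.snd) (Primrec.const []))
  refine Primrec.of_eq this fun q => ?_
  obtain ⟨⟨x, b⟩, y⟩ := q
  induction y with
  | zero => rfl
  | succ y ih =>
    simp only at ih ⊢
    rw [ih]
    rfl

theorem samples_primRec {k : ℕ} {f : (Fin k → ℕ) → ℕ → ℝ} {g : (Fin (k + 2) → ℕ) → ℕ → ℝ}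
    {S T : List ℕ → Sampler ℕ} (hS : Samples S f) (hT : Samples T g) :
    Samples (fun v => iter S T (v.take k) (v.getD k 0)) (primRec f g) where
  primrec := (primrec_iter hS.primrec hT.primrec).comp
    (Primrec.pair (Primrec.pair (Primrec.list_take.comp (Primrec.const k) Primrec.fst) Primrec.snd)
      ((Primrec.list_getD 0).comp Primrec.fst (Primrec.const k)))
  good v := good_iter hS.good hT.good _ _
  eq_den v w := by
    have h1 : (List.ofFn v).take k = List.ofFn (Fin.init v) := by
      rw [List.ofFn_succ', List.concat_eq_append, List.take_left' (by simp)]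
      rfl
    have h2 : (List.ofFn v).getD k 0 = v (Fin.last k) := by
      rw [List.getD_eq_getElem?_getD, List.getElem?_ofFn, dif_pos (Nat.lt_succ_self k)]
      rfl
    rw [h1, h2, primRec]
    generalize Fin.init v = x
    generalize v (Fin.last k) = y
    induction y generalizing w with
    | zero => exact hS.eq_den x w
    | succ y ih =>
      rw [primRecAux, iter, den_bind (good_iter hS.good hT.good _ _), ENNReal.tsum_toReal_eq]
      · refine tsum_congr fun z => ?_
        rw [ENNReal.toReal_mul, ih, hT.eq_den, mul_comm]
        congr 4
        rw [List.ofFn_succ', List.ofFn_succ']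
        simp
      · exact fun z => ENNReal.mul_ne_top (den_ne_top (good_iter hS.good hT.good _ _) _)
          (den_ne_top (hT.good _) _)

/-- One round of the search for a zero: a state is either a result, or the next candidate together
with the remaining coin flips. One coin flip is discarded in every unsuccessful round. -/
def searchStep (S : ℕ → Sampler ℕ) :
    Option ((ℕ × List Bool) ⊕ (ℕ × List Bool)) → Option ((ℕ × List Bool) ⊕ (ℕ × List Bool))
  | none => none
  | some (Sum.inl p) => some (Sum.inl p)
  | some (Sum.inr (z, b)) => (S z b).bind fun p =>
      if p.1 = 0 then some (Sum.inl (z, p.2))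
      else (flip p.2).map fun q => Sum.inr (z + 1, q.2)

/-- Search for the first zero at or after `z`. -/
def search (S : ℕ → Sampler ℕ) (z : ℕ) : Sampler ℕ := fun b =>
  ((searchStep S)^[b.length + 1] (some (Sum.inr (z, b)))).bind fun s => s.getLeft?

theorem searchStep_iterate_none (S : ℕ → Sampler ℕ) (n : ℕ) : (searchStep S)^[n] none = none :=
  Function.iterate_fixed rfl n

theorem searchStep_iterate_inl (S : ℕ → Sampler ℕ) (n : ℕ) (p : ℕ × List Bool) :
    (searchStep S)^[n] (some (Sum.inl p)) = some (Sum.inl p) :=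
  Function.iterate_fixed rfl n

theorem flip_length {b r : List Bool} {a : Bool} (h : flip b = some (a, r)) :
    b.length = r.length + 1 := by
  cases b with
  | nil => simp [flip] at h
  | cons x b =>
    obtain ⟨-, rfl⟩ : x = a ∧ b = r := by simpa [flip] using h
    simp

theorem Good.length_le {β : Type} {S : Sampler β} (hS : S.Good) {b r : List Bool} {y : β}
    (h : S b = some (y, r)) : r.length ≤ b.length := by
  obtain ⟨c, rfl, -⟩ := hS _ _ _ h
  simp

theorem search_fuel {S : ℕ → Sampler ℕ} (hS : ∀ z, (S z).Good) (n : ℕ) :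
    ∀ (m z : ℕ) (b : List Bool), b.length + 1 ≤ n → b.length + 1 ≤ m →
    (searchStep S)^[n] (some (Sum.inr (z, b))) = (searchStep S)^[m] (some (Sum.inr (z, b))) := by
  induction n with
  | zero => intro m z b h; omega
  | succ n ih =>
    intro m z b h h'
    obtain ⟨m, rfl⟩ : ∃ m', m = m' + 1 := ⟨m - 1, by omega⟩
    rw [Function.iterate_succ_apply, Function.iterate_succ_apply]
    cases hb : S z b with
    | none => simp [searchStep, hb, searchStep_iterate_none]
    | some p =>
      obtain ⟨k, r⟩ := p
      simp only [searchStep, hb, Option.bind_some]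
      split
      · simp only [searchStep_iterate_inl]
      · cases hr : flip r with
        | none => simp [searchStep_iterate_none]
        | some q =>
          have h1 := (hS z).length_le hb
          have h2 := flip_length hr
          exact ih _ _ _ (by omega) (by omega)

theorem search_eq {S : ℕ → Sampler ℕ} (hS : ∀ z, (S z).Good) (z : ℕ) :
    search S z = (S z).bind fun k =>
      if k = 0 then pure z else flip.bind fun _ => search S (z + 1) := by
  ext1 b
  rw [search, Function.iterate_succ_apply, bind]
  cases hb : S z b with
  | none => simp [searchStep, hb, searchStep_iterate_none]
  | some p =>
    obtain ⟨k, r⟩ := p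
    simp only [searchStep, hb, Option.bind_some]
    split
    · simp [searchStep_iterate_inl, pure]
    · rw [bind]
      cases hr : flip r with
      | none => simp [searchStep_iterate_none]
      | some q =>
        have h1 := (hS z).length_le hb
        have h2 := flip_length hr
        rw [Option.map_some, Option.bind_some, search, search_fuel hS _ _ _ _ _ le_rfl]
        omega

theorem search_spec {S : ℕ → Sampler ℕ} (hS : ∀ z, (S z).Good) (n : ℕ) :
    ∀ z b y r, List.length b ≤ n → search S z b = some (y, r) →
      z ≤ y ∧ ∃ c, b = c ++ r ∧ ∀ r', search S z (c ++ r') = some (y, r') := by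
  induction n with
  | zero =>
    intro z b y r hb h
    obtain rfl : b = [] := List.eq_nil_of_length_eq_zero (Nat.le_zero.1 hb)
    simp only [search_eq hS z] at h ⊢
    obtain ⟨⟨k, r₁⟩, h₁, h₂⟩ := Option.bind_eq_some_iff.1 h
    obtain ⟨c₁, hc, hc₁⟩ := hS z _ _ _ h₁
    obtain ⟨rfl, rfl⟩ := List.append_eq_nil_iff.1 hc.symm
    simp only at h₂
    split at h₂
    · next hk =>
      obtain ⟨rfl, rfl⟩ : z = y ∧ [] = r := by simpa [pure] using h₂
      refine ⟨le_rfl, [], rfl, fun r' => ?_⟩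
      have := hc₁ r'
      rw [List.nil_append] at this ⊢
      simp [bind, this, hk, pure]
    · simp [bind, flip] at h₂
  | succ n ih =>
    intro z b y r hb h
    rw [search_eq hS z] at h ⊢
    obtain ⟨⟨k, r₁⟩, h₁, h₂⟩ := Option.bind_eq_some_iff.1 h
    obtain ⟨c₁, rfl, hc₁⟩ := hS z _ _ _ h₁
    simp only at h₂
    split at h₂
    · next hk =>
      obtain ⟨rfl, rfl⟩ : z = y ∧ r₁ = r := by simpa [pure] using h₂
      exact ⟨le_rfl, c₁, rfl, fun r' => by simp [bind, hc₁, hk, pure]⟩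
    · next hk =>
      cases r₁ with
      | nil => simp [bind, flip] at h₂
      | cons a r₁ =>
        simp only [bind, flip, Option.bind_some] at h₂
        obtain ⟨h₃, c₂, rfl, hc₂⟩ := ih (z + 1) r₁ y r (by simp at hb; omega) h₂
        refine ⟨by omega, c₁ ++ a :: c₂, by simp, fun r' => ?_⟩
        simp [bind, hc₁, hk, flip, hc₂]

theorem good_search {S : ℕ → Sampler ℕ} (hS : ∀ z, (S z).Good) (z : ℕ) : (search S z).Good :=
  fun b y r h => (search_spec hS _ z b y r le_rfl h).2

theorem den_search_of_lt {S : ℕ → Sampler ℕ} (hS : ∀ z, (S z).Good) {y z : ℕ} (h : y < z) :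
    (search S z).den y = 0 := by
  refine ENNReal.tsum_eq_zero.2 fun c => if_neg fun hc => ?_
  have := (search_spec hS _ z c y [] le_rfl hc).1
  omega

theorem tsum_nat_eq_zero_add_pos (F : ℕ → ENNReal) :
    ∑' k, F k = F 0 + ∑' k : {m : ℕ // 0 < m}, F k := by
  have h1 : ∑' k : {m : ℕ // 0 < m}, F k = ∑' k, Set.indicator {m | 0 < m} F k :=
    tsum_subtype {m | 0 < m} F
  have h2 : F 0 = ∑' k, Set.indicator {0} F k := by
    rw [tsum_eq_single 0]
    · simp
    · intro k hk
      simp [hk]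
  rw [h1, h2, ← ENNReal.tsum_add]
  refine tsum_congr fun k => ?_
  rcases Nat.eq_zero_or_pos k with rfl | hk
  · simp
  · simp [hk, hk.ne']

theorem den_flip_bind {β : Type} (S : Sampler β) (y : β) :
    (flip.bind fun _ => S).den y = S.den y := by
  rw [den_bind good_flip, tsum_bool, den_flip, den_flip, ← add_mul, ENNReal.inv_two_add_inv_two,
    one_mul]

theorem den_search_succ {S : ℕ → Sampler ℕ} (hS : ∀ z, (S z).Good) (y z : ℕ) :
    (search S z).den y = (S z).den 0 * (if y = z then 1 else 0) +
      (∑' k : {m : ℕ // 0 < m}, (S z).den k) * (search S (z + 1)).den y := by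
  rw [search_eq hS z, den_bind (hS z), tsum_nat_eq_zero_add_pos, if_pos rfl, den_pure,
    ← ENNReal.tsum_mul_right]
  refine congrArg₂ (· + ·) (by congr) (tsum_congr fun k => ?_)
  rw [if_neg k.2.ne', den_flip_bind]

theorem den_search {S : ℕ → Sampler ℕ} (hS : ∀ z, (S z).Good) (y n : ℕ) :
    ∀ z, z + n = y → (search S z).den y =
      (S y).den 0 * ∏ i ∈ Finset.Ico z y, ∑' k : {m : ℕ // 0 < m}, (S i).den k := by
  induction n with
  | zero =>
    rintro z rfl
    rw [den_search_succ hS, den_search_of_lt hS (show z + 0 < z + 1 by omega)]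
    simp
  | succ n ih =>
    intro z hz
    have hne : y ≠ z := by omega
    rw [den_search_succ hS, ih (z + 1) (by omega), if_neg hne,
      Finset.prod_eq_prod_Ico_succ_bot (show z < y by omega)]
    ring

theorem primrec_search {S : List ℕ → Sampler ℕ} (hS : Primrec₂ S) :
    Primrec₂ fun (x : List ℕ) (b : List Bool) => search (fun z => S (x ++ [z])) 0 b := by
  have hstep : Primrec₂ fun (a : List ℕ × List Bool) =>
      searchStep (fun z => S (a.1 ++ [z])) := by
    have : Primrec₂ fun (a : List ℕ × List Bool)
        (o : Option ((ℕ × List Bool) ⊕ (ℕ × List Bool))) => o.bind fun s =>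
          (Sum.casesOn s (fun p => some (Sum.inl p)) (fun p => (S (a.1 ++ [p.1]) p.2).bind fun q =>
            if q.1 = 0 then some (Sum.inl (p.1, q.2))
            else (flip q.2).map fun t => Sum.inr (p.1 + 1, t.2)) :
            Option ((ℕ × List Bool) ⊕ (ℕ × List Bool))) := by
      refine Primrec.option_bind Primrec.snd ?_
      refine Primrec.sumCasesOn Primrec.snd
        (Primrec.option_some.comp (Primrec.sumInl.comp Primrec.snd)) ?_
      refine Primrec.option_bind (hS.comp ?_ (Primrec.snd.comp Primrec.snd)) ?_
      · exact Primrec.list_append.comp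
          (Primrec.fst.comp (Primrec.fst.comp (Primrec.fst.comp Primrec.fst)))
          (Primrec.list_cons.comp (Primrec.fst.comp Primrec.snd) (Primrec.const []))
      · refine Primrec.ite (Primrec.eq.comp (Primrec.fst.comp Primrec.snd) (Primrec.const 0)) ?_ ?_
        · exact Primrec.option_some.comp (Primrec.sumInl.comp (Primrec.pair
            (Primrec.fst.comp (Primrec.snd.comp Primrec.fst)) (Primrec.snd.comp Primrec.snd)))
        · refine Primrec.option_map (primrec_flip.comp (Primrec.snd.comp Primrec.snd)) ?_
          exact Primrec.sumInr.comp (Primrec.pair (Primrec.succ.comp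
            (Primrec.fst.comp (Primrec.snd.comp (Primrec.fst.comp Primrec.fst))))
            (Primrec.snd.comp Primrec.snd))
    refine Primrec₂.of_eq this fun a o => ?_
    rcases o with _ | (p | p) <;> rfl
  have hleft : Primrec (Sum.getLeft? : (ℕ × List Bool) ⊕ (ℕ × List Bool) → _) := by
    refine (Primrec.sumCasesOn (f := fun s : (ℕ × List Bool) ⊕ (ℕ × List Bool) => s)
      (g := fun _ p => some p) (h := fun _ _ => none) Primrec.id
      (Primrec.option_some.comp Primrec.snd) (Primrec.const none)).of_eq fun s => ?_
    cases s <;> rfl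
  refine Primrec.option_bind ?_ (hleft.comp Primrec.snd)
  exact Primrec.nat_iterate (Primrec.succ.comp (Primrec.list_length.comp Primrec.snd))
    (Primrec.option_some.comp (Primrec.sumInr.comp (Primrec.pair (Primrec.const 0) Primrec.snd)))
    hstep

theorem samples_minimize {k : ℕ} {f : (Fin (k + 1) → ℕ) → ℕ → ℝ} {S : List ℕ → Sampler ℕ}
    (hS : Samples S f) : Samples (fun x => search (fun z => S (x ++ [z])) 0) (minimize f) where
  primrec := primrec_search hS.primrec
  good x := good_search (fun z => hS.good _) 0
  eq_den x y := by
    have hsnoc : ∀ z : ℕ, List.ofFn (Fin.snoc x z : Fin (k + 1) → ℕ) = List.ofFn x ++ [z] := by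
      intro z
      rw [List.ofFn_succ']
      simp
    rw [den_search (fun z => hS.good _) y y 0 (by simp), minimize, ENNReal.toReal_mul,
      ENNReal.toReal_prod, hS.eq_den, hsnoc, Finset.range_eq_Ico]
    congr 1
    refine Finset.prod_congr rfl fun z _ => ?_
    rw [ENNReal.tsum_toReal_eq fun m => den_ne_top (hS.good _) _]
    refine tsum_congr fun m => ?_
    rw [hS.eq_den, hsnoc]

/-- Every probabilistic recursive function has a primitive recursive sampler. -/
theorem exists_samples {k : ℕ} {f : (Fin k → ℕ) → ℕ → ℝ} (hf : PR f) : ∃ S, Samples S f := by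
  induction hf with
  | zero => exact ⟨_, samples_pure (h := fun _ => 0) (Primrec.const 0) fun _ => rfl⟩
  | succ => exact ⟨_, samples_pure (h := fun x => x.headI + 1)
      (Primrec.succ.comp Primrec.list_headI) fun x => by simp⟩
  | proj m => exact ⟨_, samples_pure (h := fun x => x.getD m 0)
      ((Primrec.list_getD 0).comp Primrec.id (Primrec.const _)) fun x => by simp⟩
  | coin => exact ⟨_, samples_coin⟩
  | comp _ _ hf hg =>
    obtain ⟨S, hS⟩ := hf
    choose T hT using hg
    exact ⟨_, samples_comp hS hT⟩
  | primrec _ _ hf hg =>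
    obtain ⟨S, hS⟩ := hf
    obtain ⟨T, hT⟩ := hg
    exact ⟨_, samples_primRec hS hT⟩
  | minim _ hf =>
    obtain ⟨S, hS⟩ := hf
    exact ⟨_, samples_minimize hS⟩

end Sampler

/-! ### Values of configurations -/

section Values

variable {A : Type} (M : PTM A)

theorem Fm_mono {f g : Conf M → List A → ℝ} (h : f ≤ g) : Fm M f ≤ Fm M g := by
  intro c s
  simp only [Fm]
  split
  · exact le_rfl
  · have h1 := h (applyTrans M.δ₀ c) s
    have h2 := h (applyTrans M.δ₁ c) s
    linarith

theorem Fm_iterate_nonneg (n : ℕ) (c : Conf M) (s : List A) :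
    0 ≤ (Fm M)^[n] (fun _ _ => 0) c s := by
  induction n generalizing c with
  | zero => exact le_rfl
  | succ n ih =>
    rw [Function.iterate_succ_apply', Fm]
    have h1 := ih (applyTrans M.δ₀ c)
    have h2 := ih (applyTrans M.δ₁ c)
    split
    · split <;> norm_num
    · linarith

theorem Fm_iterate_le_one (n : ℕ) (c : Conf M) (s : List A) :
    (Fm M)^[n] (fun _ _ => 0) c s ≤ 1 := by
  induction n generalizing c with
  | zero => exact zero_le_one
  | succ n ih =>
    rw [Function.iterate_succ_apply', Fm]
    have h1 := ih (applyTrans M.δ₀ c)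
    have h2 := ih (applyTrans M.δ₁ c)
    split
    · split <;> norm_num
    · linarith

theorem Fm_iterate_monotone (c : Conf M) (s : List A) :
    Monotone fun n => (Fm M)^[n] (fun _ _ => 0) c s := by
  have h : ∀ n, (Fm M)^[n] (fun _ _ => 0) ≤ (Fm M)^[n + 1] (fun _ _ => 0) := by
    intro n
    induction n with
    | zero => exact fun c s => Fm_iterate_nonneg M 1 c s
    | succ n ih =>
      rw [Function.iterate_succ_apply', Function.iterate_succ_apply' _ (n + 1)]
      exact Fm_mono M ih
  exact monotone_nat_of_le_succ fun n => h n c s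

theorem bddAbove_Fm_iterate (c : Conf M) (s : List A) :
    BddAbove (Set.range fun n => (Fm M)^[n] (fun _ _ => 0) c s) :=
  ⟨1, by rintro _ ⟨n, rfl⟩; exact Fm_iterate_le_one M n c s⟩

theorem Fm_iterate_le_lfpFm (n : ℕ) (c : Conf M) (s : List A) :
    (Fm M)^[n] (fun _ _ => 0) c s ≤ lfpFm M c s :=
  le_ciSup (bddAbove_Fm_iterate M c s) n

theorem tendsto_Fm_iterate (c : Conf M) (s : List A) :
    Filter.Tendsto (fun n => (Fm M)^[n] (fun _ _ => 0) c s) Filter.atTop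
      (nhds (lfpFm M c s)) :=
  tendsto_atTop_ciSup (Fm_iterate_monotone M c s) (bddAbove_Fm_iterate M c s)

/-- The supremum of the iterates is a fixpoint. -/
theorem lfpFm_eq_Fm : lfpFm M = Fm M (lfpFm M) := by
  funext c s
  have h := (tendsto_Fm_iterate M c s).comp (Filter.tendsto_add_atTop_nat 1)
  refine tendsto_nhds_unique h ?_
  simp only [Function.comp_def, Function.iterate_succ_apply', Fm]
  split
  · exact tendsto_const_nhds
  · exact ((tendsto_Fm_iterate M _ s).const_mul _).add ((tendsto_Fm_iterate M _ s).const_mul _)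

variable {M}

/-- A configuration on which both transition functions agree has the value of its successor. -/
theorem Fm_of_applyTrans_eq {f : Conf M → List A → ℝ} {c c' : Conf M} (hc : ¬ c.IsFinal)
    (h₀ : applyTrans M.δ₀ c = c') (h₁ : applyTrans M.δ₁ c = c') : Fm M f c = f c' := by
  funext s
  rw [Fm, if_neg hc, h₀, h₁]
  ring

/-- `c` has the same limit value as `c'`, which is approximated at least as fast from `c'`. -/
def Conf.Delays (c c' : Conf M) : Prop :=
  lfpFm M c = lfpFm M c' ∧
    ∀ n, (Fm M)^[n] (fun _ _ => 0) c ≤ (Fm M)^[n] (fun _ _ => 0) c'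

theorem Conf.Delays.trans {c₁ c₂ c₃ : Conf M} (h : c₁.Delays c₂) (h' : c₂.Delays c₃) :
    c₁.Delays c₃ :=
  ⟨h.1.trans h'.1, fun n => (h.2 n).trans (h'.2 n)⟩

theorem Conf.Delays.of_applyTrans_eq {c c' : Conf M} (hc : ¬ c.IsFinal)
    (h₀ : applyTrans M.δ₀ c = c') (h₁ : applyTrans M.δ₁ c = c') : c.Delays c' := by
  constructor
  · rw [lfpFm_eq_Fm, Fm_of_applyTrans_eq hc h₀ h₁, ← lfpFm_eq_Fm]
  · intro n s
    refine (Fm_iterate_monotone M c s (Nat.le_succ n)).trans ?_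
    simp only [Function.iterate_succ_apply', Fm_of_applyTrans_eq hc h₀ h₁]
    exact le_rfl

end Values

/-! ### Structured tape programs -/

/-- Structured programs acting on a tape over `Option Bool`. -/
inductive TProg where
  /-- Rewrite the scanned symbol and move. -/
  | act (f : Option Bool → Option Bool) (d : Move)
  /-- Sequential composition. -/
  | seq (p q : TProg)
  /-- Branching on the scanned symbol. -/
  | ite (t : Option Bool → Bool) (p q : TProg)
  /-- Repetition as long as the scanned symbol passes a test. -/
  | loop (t : Option Bool → Bool) (p : TProg)
  /-- A fair coin. -/
  | coin (p q : TProg)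

namespace TProg

/-- The stack of programs left to run after one step reading the symbol `a`, with coin `b`. -/
def next (b : Bool) (a : Option Bool) : List TProg → List TProg
  | [] => []
  | act _ _ :: K => K
  | seq p q :: K => p :: q :: K
  | ite t p q :: K => (if t a then p else q) :: K
  | loop t p :: K => if t a then p :: loop t p :: K else K
  | coin p q :: K => (if b then q else p) :: K

/-- One step: new stack, flag telling whether the last move to the right is to be undone, written
symbol and head move. -/
def step (b : Bool) (K : List TProg) : Bool → Option Bool →
    (List TProg × Bool) × Option Bool × Move
  | true, a => ((K, false), a, .left)
  | false, a =>
    match K with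
    | [] => (([], false), a, .right)
    | act f d :: K => ((K, false), f a, d)
    | p :: K => ((next b a (p :: K), true), a, .right)

/-- The stacks that may occur while `p` runs on top of the stack `K`. -/
def conts : TProg → List TProg → Set (List TProg)
  | act f d, K => {act f d :: K}
  | seq p q, K => {seq p q :: K} ∪ (conts p (q :: K) ∪ conts q K)
  | ite t p q, K => {ite t p q :: K} ∪ (conts p K ∪ conts q K)
  | loop t p, K => {loop t p :: K} ∪ conts p (loop t p :: K)
  | coin p q, K => {coin p q :: K} ∪ (conts p K ∪ conts q K)

theorem finite_conts (p : TProg) (K : List TProg) : (conts p K).Finite := by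
  induction p generalizing K with
  | act f d => exact Set.finite_singleton _
  | seq p q ihp ihq => exact (Set.finite_singleton _).union ((ihp _).union (ihq _))
  | ite t p q ihp ihq => exact (Set.finite_singleton _).union ((ihp _).union (ihq _))
  | loop t p ih => exact (Set.finite_singleton _).union (ih _)
  | coin p q ihp ihq => exact (Set.finite_singleton _).union ((ihp _).union (ihq _))

theorem cons_mem_conts (p : TProg) (K : List TProg) : p :: K ∈ conts p K := by
  cases p <;> simp [conts]

theorem next_mem_conts (b : Bool) (a : Option Bool) (p : TProg) (K L : List TProg)
    (h : L ∈ conts p K) : next b a L ∈ insert K (conts p K) := by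
  induction p generalizing K with
  | act f d =>
    obtain rfl : L = act f d :: K := h
    exact Or.inl rfl
  | seq p q ihp ihq =>
    rcases h with h | h | h
    · obtain rfl : L = seq p q :: K := h
      exact Or.inr (Or.inr (Or.inl (cons_mem_conts p _)))
    · rcases ihp _ h with h | h
      · exact Or.inr (Or.inr (Or.inr (h ▸ cons_mem_conts q _)))
      · exact Or.inr (Or.inr (Or.inl h))
    · rcases ihq _ h with h | h
      · exact Or.inl h
      · exact Or.inr (Or.inr (Or.inr h))
  | ite t p q ihp ihq =>
    rcases h with h | h | h
    · obtain rfl : L = ite t p q :: K := h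
      by_cases ht : t a
      · exact Or.inr (Or.inr (Or.inl (by simp [next, ht, cons_mem_conts])))
      · exact Or.inr (Or.inr (Or.inr (by simp [next, ht, cons_mem_conts])))
    · rcases ihp _ h with h | h
      · exact Or.inl h
      · exact Or.inr (Or.inr (Or.inl h))
    · rcases ihq _ h with h | h
      · exact Or.inl h
      · exact Or.inr (Or.inr (Or.inr h))
  | loop t p ih =>
    rcases h with h | h
    · obtain rfl : L = loop t p :: K := h
      by_cases ht : t a
      · exact Or.inr (Or.inr (by simp [next, ht, cons_mem_conts]))
      · exact Or.inl (by simp [next, ht])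
    · rcases ih _ h with h | h
      · exact Or.inr (Or.inl h)
      · exact Or.inr (Or.inr h)
  | coin p q ihp ihq =>
    rcases h with h | h | h
    · obtain rfl : L = coin p q :: K := h
      cases b
      · exact Or.inr (Or.inr (Or.inl (by simp [next, cons_mem_conts])))
      · exact Or.inr (Or.inr (Or.inr (by simp [next, cons_mem_conts])))
    · rcases ihp _ h with h | h
      · exact Or.inl h
      · exact Or.inr (Or.inr (Or.inl h))
    · rcases ihq _ h with h | h
      · exact Or.inl h
      · exact Or.inr (Or.inr (Or.inr h))

/-- The stacks occurring in a run of `p`. -/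
abbrev Stack (p : TProg) : Type := {K : List TProg // K ∈ insert [] (conts p [])}

theorem step_fst (b : Bool) (K : List TProg) (i : Bool) (a : Option Bool) :
    (step b K i a).1.1 = if i then K else next b a K := by
  cases i
  · rcases K with _ | ⟨p, K⟩
    · rfl
    · cases p <;> rfl
  · rfl

theorem step_mem (p : TProg) (b : Bool) (K : Stack p) (i : Bool) (a : Option Bool) :
    (step b K.1 i a).1.1 ∈ insert [] (conts p []) := by
  rw [step_fst]
  split
  · exact K.2
  · rcases K with ⟨K, hK | hK⟩
    · subst hK
      exact Or.inl rfl
    · exact next_mem_conts b a p [] K hK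

/-- The transition function of the machine running `p`. -/
def trans (p : TProg) (b : Bool) (q : Stack p × Bool) (a : Option Bool) :
    (Stack p × Bool) × Option Bool × Move :=
  ((⟨(step b q.1.1 q.2 a).1.1, step_mem p b q.1 q.2 a⟩, (step b q.1.1 q.2 a).1.2),
    (step b q.1.1 q.2 a).2)

/-- The probabilistic Turing machine running a program. -/
def machine (p : TProg) : PTM Bool where
  Q := Stack p × Bool
  finQ :=
    haveI : Fintype (Stack p) := ((finite_conts p []).insert []).fintype
    inferInstance
  init := (⟨[p], Or.inr (cons_mem_conts p [])⟩, false)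
  final := {q | q.1.1 = [] ∧ q.2 = false}
  δ₀ := trans p false
  δ₁ := trans p true

/-- Machine states over a two-sided infinite tape. -/
structure State where
  /-- The programs left to run. -/
  stack : List TProg
  /-- Whether the last move to the right is to be undone. -/
  undo : Bool
  /-- The tape. -/
  tape : ℤ → Option Bool
  /-- The position of the head. -/
  head : ℤ

/-- The displacement of a move. -/
def shift : Move → ℤ
  | .left => -1
  | .right => 1

/-- The state obtained from `s` by performing the result `r` of a step. -/
def State.perform (s : State) (r : (List TProg × Bool) × Option Bool × Move) : State :=
  ⟨r.1.1, r.1.2, Function.update s.tape s.head r.2.1, s.head + shift r.2.2⟩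

/-- One step with the coin showing `b`. -/
def State.succ (b : Bool) (s : State) : State :=
  s.perform (step b s.stack s.undo (s.tape s.head))

/-- A configuration of the machine represents a state. -/
structure Sim {p : TProg} (c : Conf p.machine) (s : State) : Prop where
  stack : c.state.1.1 = s.stack
  undo : c.state.2 = s.undo
  scan : c.scan = s.tape s.head
  left : ∀ i : ℕ, c.left[i]?.getD none = s.tape (s.head - 1 - i)
  right : ∀ i : ℕ, c.right[i]?.getD none = s.tape (s.head + 1 + i)

theorem Sim.applyTrans {p : TProg} {c : Conf p.machine} {s : State} (h : Sim c s) (b : Bool) :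
    Sim (applyTrans (M := p.machine) (p.trans b) c) (s.succ b) := by
  obtain ⟨left, scan, right, q⟩ := c
  obtain ⟨K, i, T, x⟩ := s
  obtain ⟨h1, h2, h3, h4, h5⟩ := h
  simp only at h1 h2 h3 h4 h5
  subst h1 h2 h3
  simp only [State.succ, State.perform]
  rcases hr : step b q.1.1 q.2 (T x) with ⟨⟨K', i'⟩, e, d⟩
  have hq : p.trans b q (T x) =
      ((⟨K', by have := step_mem p b q.1 q.2 (T x); rwa [hr] at this⟩, i'), e, d) := by
    simp [trans, hr]
  have hne : ∀ j : ℕ, x - 1 - (j : ℤ) ≠ x := fun j => by omega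
  have hne' : ∀ j : ℕ, x + 1 + (j : ℤ) ≠ x := fun j => by omega
  cases d
  · rcases left with _ | ⟨l, ls⟩
    · have h0 : ∀ j : ℕ, T (x - 1 - j) = none := fun j => by rw [← h4]; simp
      refine ⟨?_, ?_, ?_, fun j => ?_, fun j => ?_⟩ <;>
        simp only [_root_.applyTrans, hq, shift]
      · rw [Function.update_of_ne (by omega)]
        simpa [sub_eq_add_neg] using (h0 0).symm
      · rw [Function.update_of_ne (by omega)]
        have := (h0 (j + 1)).symm
        simpa [sub_eq_add_neg, add_assoc, add_comm, add_left_comm] using this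
      · rcases j with _ | j
        · simp
        · rw [Function.update_of_ne (by omega), List.getElem?_cons_succ, h5]
          congr 1
          push_cast
          ring
    · refine ⟨?_, ?_, ?_, fun j => ?_, fun j => ?_⟩ <;>
        simp only [_root_.applyTrans, hq, shift]
      · rw [Function.update_of_ne (by omega)]
        simpa [sub_eq_add_neg] using h4 0
      · rw [Function.update_of_ne (by omega)]
        have := h4 (j + 1)
        rw [List.getElem?_cons_succ] at this
        rw [this]
        congr 1
        push_cast
        ring
      · rcases j with _ | j
        · simp
        · rw [Function.update_of_ne (by omega), List.getElem?_cons_succ, h5]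
          congr 1
          push_cast
          ring
  · rcases right with _ | ⟨l, ls⟩
    · have h0 : ∀ j : ℕ, T (x + 1 + j) = none := fun j => by rw [← h5]; simp
      refine ⟨?_, ?_, ?_, fun j => ?_, fun j => ?_⟩ <;>
        simp only [_root_.applyTrans, hq, shift]
      · rw [Function.update_of_ne (by omega)]
        simpa using (h0 0).symm
      · rcases j with _ | j
        · simp
        · rw [Function.update_of_ne (by omega), List.getElem?_cons_succ, h4]
          congr 1
          push_cast
          ring
      · rw [Function.update_of_ne (by omega)]
        have := (h0 (j + 1)).symm
        simpa [add_assoc, add_comm, add_left_comm] using this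
    · refine ⟨?_, ?_, ?_, fun j => ?_, fun j => ?_⟩ <;>
        simp only [_root_.applyTrans, hq, shift]
      · rw [Function.update_of_ne (by omega)]
        simpa using h5 0
      · rcases j with _ | j
        · simp
        · rw [Function.update_of_ne (by omega), List.getElem?_cons_succ, h4]
          congr 1
          push_cast
          ring
      · rw [Function.update_of_ne (by omega)]
        have := h5 (j + 1)
        rw [List.getElem?_cons_succ] at this
        rw [this]
        congr 1
        push_cast
        ring

/-- A step of a running state that does not depend on the coin. -/
def State.Step (s s' : State) : Prop :=
  (s.stack ≠ [] ∨ s.undo = true) ∧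
    (∀ b, step b s.stack s.undo (s.tape s.head) = step false s.stack s.undo (s.tape s.head)) ∧
    s.succ false = s'

/-- Reachability by steps that do not depend on the coin. -/
def State.Reaches : State → State → Prop := Relation.ReflTransGen State.Step

theorem Sim.exists_delays {p : TProg} {c : Conf p.machine} {s s' : State} (h : Sim c s)
    (hs : s.Reaches s') : ∃ c' : Conf p.machine, Sim c' s' ∧ c.Delays c' := by
  induction hs with
  | refl => exact ⟨c, h, rfl, fun _ => le_rfl⟩
  | @tail s₁ s₂ _ hs ih =>
    obtain ⟨c₁, h₁, hd⟩ := ih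
    obtain ⟨hr, hb, rfl⟩ := hs
    refine ⟨_, h₁.applyTrans false, hd.trans (.of_applyTrans_eq ?_ rfl ?_)⟩
    · rintro ⟨hK, hi⟩
      rw [h₁.stack] at hK
      rw [h₁.undo] at hi
      simp [hK, hi] at hr
    · have : p.trans true c₁.state c₁.scan = p.trans false c₁.state c₁.scan := by
        have := hb true
        rw [← h₁.stack, ← h₁.undo, ← h₁.scan] at this
        simp only [trans, this]
      simp only [_root_.applyTrans, machine, this]

/-- The probability that a run that outputs `D w` once the coin flips `w` (latest first) are
defined yields `y` after less than `n` further coin flips. -/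
def runVal (D : List Bool → Option (List Bool)) (y : List Bool) : ℕ → List Bool → ℝ
  | 0, _ => 0
  | n + 1, w =>
    match D w with
    | some o => if y = o then 1 else 0
    | none => 1 / 2 * runVal D y n (false :: w) + 1 / 2 * runVal D y n (true :: w)

theorem runVal_some {D : List Bool → Option (List Bool)} {w o : List Bool} (h : D w = some o)
    (y : List Bool) (n : ℕ) : runVal D y (n + 1) w = if y = o then 1 else 0 := by
  simp [runVal, h]

theorem runVal_none {D : List Bool → Option (List Bool)} {w : List Bool} (h : D w = none)
    (y : List Bool) (n : ℕ) : runVal D y (n + 1) w =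
      1 / 2 * runVal D y n (false :: w) + 1 / 2 * runVal D y n (true :: w) := by
  simp [runVal, h]

section Run

variable {P : TProg} {D : List Bool → Option (List Bool)} {a : List Bool → State}
  (hsome : ∀ w o, D w = some o → ∃ T h, (a w).Reaches ⟨[], false, T, h⟩ ∧
    ∀ c : Conf P.machine, Sim c ⟨[], false, T, h⟩ → outStr c = o)
  (hnone : ∀ w, D w = none → ∃ p q K T h, (a w).Reaches ⟨coin p q :: K, false, T, h⟩ ∧
    State.Reaches ⟨p :: K, true, T, h + 1⟩ (a (false :: w)) ∧
    State.Reaches ⟨q :: K, true, T, h + 1⟩ (a (true :: w)))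

include hsome in
theorem exists_delays_final {c : Conf P.machine} {w o : List Bool} (hc : Sim c (a w))
    (hw : D w = some o) :
    ∃ c' : Conf P.machine, c.Delays c' ∧ ∀ f y, Fm P.machine f c' y = if y = o then 1 else 0 := by
  obtain ⟨T, h, hr, ho⟩ := hsome w o hw
  obtain ⟨c', hc', hd⟩ := hc.exists_delays hr
  refine ⟨c', hd, fun f y => ?_⟩
  rw [Fm, if_pos ⟨hc'.stack, hc'.undo⟩, ho c' hc']
  congr

include hnone in
theorem exists_delays_coin {c : Conf P.machine} {w : List Bool} (hc : Sim c (a w))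
    (hw : D w = none) :
    ∃ c' c₀ c₁ c₀' c₁' : Conf P.machine, c.Delays c' ∧
      (∀ f y, Fm P.machine f c' y = 1 / 2 * f c₀ y + 1 / 2 * f c₁ y) ∧
      c₀.Delays c₀' ∧ c₁.Delays c₁' ∧ Sim c₀' (a (false :: w)) ∧ Sim c₁' (a (true :: w)) := by
  obtain ⟨p, q, K, T, h, hr, h₀, h₁⟩ := hnone w hw
  obtain ⟨c', hc', hd⟩ := hc.exists_delays hr
  have e₀ := hc'.applyTrans false
  have e₁ := hc'.applyTrans true
  simp only [State.succ, State.perform, step, next, Function.update_eq_self, shift] at e₀ e₁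
  obtain ⟨c₀', hc₀, hd₀⟩ := e₀.exists_delays h₀
  obtain ⟨c₁', hc₁, hd₁⟩ := e₁.exists_delays h₁
  refine ⟨c', _, _, c₀', c₁', hd, fun f y => ?_, hd₀, hd₁, hc₀, hc₁⟩
  rw [Fm, if_neg]
  · rfl
  · rintro ⟨hK, -⟩
    rw [hc'.stack] at hK
    simp at hK

include hsome hnone in
theorem Fm_iterate_le_runVal (y : List Bool) (n : ℕ) (c : Conf P.machine) (w : List Bool)
    (hc : Sim c (a w)) : (Fm P.machine)^[n] (fun _ _ => 0) c y ≤ runVal D y n w := by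
  induction n generalizing c w with
  | zero => exact le_rfl
  | succ n ih =>
    cases hw : D w with
    | some o =>
      obtain ⟨c', hd, hF⟩ := exists_delays_final hsome hc hw
      refine (hd.2 (n + 1) y).trans ?_
      rw [Function.iterate_succ_apply', hF, runVal_some hw]
    | none =>
      obtain ⟨c', c₀, c₁, c₀', c₁', hd, hF, hd₀, hd₁, hs₀, hs₁⟩ := exists_delays_coin hnone hc hw
      refine (hd.2 (n + 1) y).trans ?_
      rw [Function.iterate_succ_apply', hF, runVal_none hw]
      have h₀ := (hd₀.2 n y).trans (ih _ _ hs₀)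
      have h₁ := (hd₁.2 n y).trans (ih _ _ hs₁)
      linarith

include hsome hnone in
theorem runVal_le_lfpFm (y : List Bool) (n : ℕ) (c : Conf P.machine) (w : List Bool)
    (hc : Sim c (a w)) : runVal D y n w ≤ lfpFm P.machine c y := by
  induction n generalizing c w with
  | zero => exact Fm_iterate_le_lfpFm P.machine 0 c y
  | succ n ih =>
    cases hw : D w with
    | some o =>
      obtain ⟨c', hd, hF⟩ := exists_delays_final hsome hc hw
      rw [hd.1, lfpFm_eq_Fm, hF, runVal_some hw]
    | none =>
      obtain ⟨c', c₀, c₁, c₀', c₁', hd, hF, hd₀, hd₁, hs₀, hs₁⟩ := exists_delays_coin hnone hc hw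
      rw [hd.1, lfpFm_eq_Fm, hF, runVal_none hw, hd₀.1, hd₁.1]
      have h₀ := ih _ _ hs₀
      have h₁ := ih _ _ hs₁
      linarith

include hsome hnone in
/-- The value of a machine whose behaviour is described by its coin flips. -/
theorem lfpFm_eq_iSup_runVal {c : Conf P.machine} (hc : Sim c (a [])) (y : List Bool) :
    lfpFm P.machine c y = ⨆ n, runVal D y n [] := by
  refine le_antisymm (ciSup_mono ?_ fun n => Fm_iterate_le_runVal hsome hnone y n c [] hc)
    (ciSup_le fun n => runVal_le_lfpFm hsome hnone y n c [] hc)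
  exact ⟨lfpFm P.machine c y, by
    rintro _ ⟨n, rfl⟩
    exact runVal_le_lfpFm hsome hnone y n c [] hc⟩

end Run

/-! ### Runs of structured programs -/

/-- `p` transforms the tape `T` with head position `h` into `T'` with head position `h'`. -/
def Does (p : TProg) (T : ℤ → Option Bool) (h : ℤ) (T' : ℤ → Option Bool) (h' : ℤ) : Prop :=
  ∀ K, State.Reaches ⟨p :: K, false, T, h⟩ ⟨K, false, T', h'⟩

theorem reaches_undo (K : List TProg) (T : ℤ → Option Bool) (h : ℤ) :
    State.Reaches ⟨K, true, T, h + 1⟩ ⟨K, false, T, h⟩ := by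
  refine .single ⟨Or.inr rfl, fun b => rfl, ?_⟩
  simp [State.succ, State.perform, step, shift]

theorem reaches_stay {p : TProg} {K K' : List TProg} {T : ℤ → Option Bool} {h : ℤ}
    (hp : ∀ b, step b (p :: K) false (T h) = ((K', true), T h, .right)) :
    State.Reaches ⟨p :: K, false, T, h⟩ ⟨K', false, T, h⟩ := by
  refine .head ⟨Or.inl (by simp), fun b => ?_, ?_⟩ (reaches_undo K' T h)
  · simp only [hp]
  · simp [State.succ, State.perform, hp, shift]

theorem does_act (f : Option Bool → Option Bool) (d : Move) (T : ℤ → Option Bool) (h : ℤ) :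
    Does (act f d) T h (Function.update T h (f (T h))) (h + shift d) := fun _ =>
  .single ⟨Or.inl (by simp), fun _ => rfl, rfl⟩

theorem Does.seq {p q : TProg} {T T' T'' : ℤ → Option Bool} {h h' h'' : ℤ}
    (hp : Does p T h T' h') (hq : Does q T' h' T'' h'') : Does (seq p q) T h T'' h'' := fun K =>
  ((reaches_stay fun _ => rfl).trans (hp (q :: K))).trans (hq K)

theorem Does.ite_true {t : Option Bool → Bool} {p : TProg} (q : TProg)
    {T T' : ℤ → Option Bool} {h h' : ℤ} (ht : t (T h) = true) (hp : Does p T h T' h') :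
    Does (ite t p q) T h T' h' := fun K =>
  (reaches_stay fun _ => by simp [step, next, ht]).trans (hp K)

theorem Does.ite_false {t : Option Bool → Bool} (p : TProg) {q : TProg}
    {T T' : ℤ → Option Bool} {h h' : ℤ} (ht : t (T h) = false) (hq : Does q T h T' h') :
    Does (ite t p q) T h T' h' := fun K =>
  (reaches_stay fun _ => by simp [step, next, ht]).trans (hq K)

theorem does_loop_done {t : Option Bool → Bool} (p : TProg) {T : ℤ → Option Bool} {h : ℤ}
    (ht : t (T h) = false) : Does (loop t p) T h T h := fun _ =>
  reaches_stay fun _ => by simp [step, next, ht]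

theorem reaches_loop {t : Option Bool → Bool} (p : TProg) (K : List TProg) {T : ℤ → Option Bool}
    {h : ℤ} (ht : t (T h) = true) :
    State.Reaches ⟨loop t p :: K, false, T, h⟩ ⟨p :: loop t p :: K, false, T, h⟩ :=
  reaches_stay fun _ => by simp [step, next, ht]

theorem Does.loop {t : Option Bool → Bool} {p : TProg} {T T' T'' : ℤ → Option Bool}
    {h h' h'' : ℤ} (ht : t (T h) = true) (hp : Does p T h T' h')
    (hl : Does (loop t p) T' h' T'' h'') : Does (loop t p) T h T'' h'' := fun K =>
  ((reaches_loop p K ht).trans (hp _)).trans (hl K)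

end TProg

/-! ### Counter programs -/

namespace TProg

theorem Does.cast {p : TProg} {T T' U U' : ℤ → Option Bool} {h h' k k' : ℤ}
    (hp : Does p T h T' h') (hT : T = U) (hh : h = k) (hT' : T' = U') (hh' : h' = k') :
    Does p U k U' k' := by
  subst hT hh hT' hh'
  exact hp

/-- The program doing nothing. -/
def skip : TProg := loop (fun _ => false) (act id .left)

theorem does_skip (T : ℤ → Option Bool) (h : ℤ) : Does skip T h T h := does_loop_done _ rfl

/-- Move the head `k` times. -/
def moves (d : Move) : ℕ → TProg
  | 0 => skip
  | k + 1 => seq (act id d) (moves d k)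

theorem does_moves (d : Move) (k : ℕ) (T : ℤ → Option Bool) (h : ℤ) :
    Does (moves d k) T h T (h + k * shift d) := by
  induction k generalizing h with
  | zero => exact (does_skip T h).cast rfl rfl rfl (by simp)
  | succ k ih =>
    refine ((does_act id d T h).cast rfl rfl (Function.update_eq_self _ _) rfl).seq ?_
    refine (ih _).cast rfl rfl rfl ?_
    push_cast
    ring

/-- Move in strides of length `k` up to a blank. -/
def scan (d : Move) (k : ℕ) : TProg := loop Option.isSome (moves d k)

theorem does_scan (d : Move) (k m : ℕ) (T : ℤ → Option Bool) (h : ℤ)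
    (hs : ∀ j < m, (T (h + j * (k * shift d))).isSome = true)
    (hm : T (h + m * (k * shift d)) = none) :
    Does (scan d k) T h T (h + m * (k * shift d)) := by
  induction m generalizing h with
  | zero =>
    refine (does_loop_done _ ?_).cast rfl rfl rfl (by simp)
    simpa using hm
  | succ m ih =>
    have e : ∀ j : ℕ, h + ((j + 1 : ℕ) : ℤ) * (k * shift d) =
        h + k * shift d + j * (k * shift d) := fun j => by push_cast; ring
    refine Does.loop (by simpa using hs 0 (by omega)) (does_moves d k T h) ?_
    rw [e] at hm ⊢
    refine ih _ (fun j hj => ?_) hm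
    rw [← e]
    exact hs (j + 1) (by omega)

/-- The tape holding the stack `w` to the left of the origin, and to the right of it the registers
`σ 0, …, σ (n - 1)` in unary, interleaved after an empty block. -/
def regTape (n : ℕ) (w : List Bool) (σ : ℕ → ℕ) : ℤ → Option Bool
  | .ofNat k => if 0 < k / n ∧ k / n ≤ σ (k % n) then some true else none
  | .negSucc k => w.reverse[k]?

variable {n : ℕ}

theorem regTape_natCast (w : List Bool) (σ : ℕ → ℕ) (k : ℕ) :
    regTape n w σ k = if 0 < k / n ∧ k / n ≤ σ (k % n) then some true else none := rfl

theorem regTape_block {i : ℕ} (hi : i < n) (w : List Bool) (σ : ℕ → ℕ) (j : ℕ) :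
    regTape n w σ (i + j * n) = if 0 < j ∧ j ≤ σ i then some true else none := by
  have h1 : (i + j * n) / n = j := by
    rw [Nat.add_mul_div_right _ _ (by omega), Nat.div_eq_of_lt hi, zero_add]
  have h2 : (i + j * n) % n = i := by rw [Nat.add_mul_mod_self_right, Nat.mod_eq_of_lt hi]
  have := regTape_natCast (n := n) w σ (i + j * n)
  rw [h1, h2] at this
  exact_mod_cast this

theorem regTape_update_reg {i : ℕ} (hi : i < n) (w : List Bool) (σ : ℕ → ℕ) {j k : ℕ} {a}
    (hj : 0 < j) (hk : ∀ l, l ≠ j → (l ≤ k ↔ l ≤ σ i))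
    (ha : a = if j ≤ k then some true else none) :
    Function.update (regTape n w σ) (i + j * n) a = regTape n w (Function.update σ i k) := by
  funext z
  by_cases hz : z = i + j * n
  · subst hz
    rw [Function.update_self, regTape_block hi, Function.update_self, ha]
    simp [hj]
  · rw [Function.update_of_ne hz]
    rcases z with m | m
    · show regTape n w σ m = regTape n w _ m
      rw [regTape_natCast, regTape_natCast]
      by_cases hm : m % n = i
      · have hne : m / n ≠ j := by
          rintro rfl
          have := Nat.mod_add_div m n
          apply hz
          rw [← hm, mul_comm, Int.ofNat_eq_natCast]
          exact_mod_cast this.symm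
        simp only [hm, Function.update_self, hk _ hne]
      · rw [Function.update_of_ne hm]
    · rfl

/-- `p`, started and ending at the origin, transforms stack and registers. -/
def DoesR (n : ℕ) (p : TProg) (w : List Bool) (σ : ℕ → ℕ) (w' : List Bool) (σ' : ℕ → ℕ) : Prop :=
  Does p (regTape n w σ) 0 (regTape n w' σ') 0

theorem DoesR.seq {p q : TProg} {w w' w'' : List Bool} {σ σ' σ'' : ℕ → ℕ}
    (hp : DoesR n p w σ w' σ') (hq : DoesR n q w' σ' w'' σ'') :
    DoesR n (seq p q) w σ w'' σ'' :=
  Does.seq hp hq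

theorem DoesR.cast {p : TProg} {w w' v v' : List Bool} {σ σ' τ τ' : ℕ → ℕ}
    (hp : DoesR n p w σ w' σ') (hw : w = v) (hσ : σ = τ) (hw' : w' = v') (hσ' : σ' = τ') :
    DoesR n p v τ v' τ' := by
  subst hw hσ hw' hσ'
  exact hp

theorem doesR_skip (w : List Bool) (σ : ℕ → ℕ) : DoesR n skip w σ w σ := does_skip _ _

theorem does_right (k : ℕ) (T : ℤ → Option Bool) (h : ℤ) : Does (moves .right k) T h T (h + k) :=
  (does_moves _ _ _ _).cast rfl rfl rfl (by simp [shift])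

theorem does_left (k : ℕ) (T : ℤ → Option Bool) (h : ℤ) : Does (moves .left k) T h T (h - k) :=
  (does_moves _ _ _ _).cast rfl rfl rfl (by simp [shift, sub_eq_add_neg])

theorem does_write_right (a : Option Bool) (T : ℤ → Option Bool) (h : ℤ) :
    Does (act (fun _ => a) .right) T h (Function.update T h a) (h + 1) :=
  does_act _ _ _ _

/-- Increment a register. -/
def inc (n i : ℕ) : TProg :=
  seq (moves .right (i + n)) (seq (scan .right n) (seq (act (fun _ => some true) .right)
    (seq (moves .left 1) (seq (scan .left n) (moves .left i)))))

theorem does_scan_up {i : ℕ} (hi : i < n) (w : List Bool) (σ : ℕ → ℕ) :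
    Does (scan .right n) (regTape n w σ) (i + (1 : ℕ) * n) (regTape n w σ)
      (i + (σ i + 1 : ℕ) * n) := by
  have e : ∀ j : ℕ, (i : ℤ) + (1 : ℕ) * n + j * (n * shift .right) = i + (j + 1 : ℕ) * n :=
    fun j => by simp only [shift]; push_cast; ring
  refine (does_scan .right n (σ i) _ _ (fun j hj => ?_) ?_).cast rfl rfl rfl (e _)
  · rw [e, regTape_block hi, if_pos ⟨by omega, by omega⟩]
    rfl
  · rw [e, regTape_block hi, if_neg (by omega)]

theorem does_scan_down {i : ℕ} (hi : i < n) (w : List Bool) (σ : ℕ → ℕ) {k : ℕ} (hk : k ≤ σ i) :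
    Does (scan .left n) (regTape n w σ) (i + k * n) (regTape n w σ) i := by
  have e : ∀ j ≤ k, (i : ℤ) + k * n + j * (n * shift .left) = i + (k - j : ℕ) * n :=
    fun j hj => by simp only [shift]; push_cast [hj]; ring
  refine (does_scan .left n k _ _ (fun j hj => ?_) ?_).cast rfl rfl rfl (by rw [e k le_rfl]; simp)
  · rw [e j hj.le, regTape_block hi, if_pos ⟨by omega, by omega⟩]
    rfl
  · rw [e k le_rfl, regTape_block hi, if_neg (by omega)]

theorem doesR_inc {i : ℕ} (hi : i < n) (w : List Bool) (σ : ℕ → ℕ) :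
    DoesR n (inc n i) w σ w (Function.update σ i (σ i + 1)) := by
  refine ((does_right _ _ _).cast rfl rfl rfl ?_).seq ((does_scan_up hi w σ).seq
    (((does_write_right _ _ _).cast rfl rfl
      (regTape_update_reg (k := σ i + 1) hi w σ (by omega) (by omega) (by simp)) rfl).seq
    (((does_left _ _ _).cast rfl rfl rfl ?_).seq
    ((does_scan_down hi w _ (k := σ i + 1) (by simp)).seq
    ((does_left _ _ _).cast rfl rfl rfl ?_)))))
  · push_cast; ring
  · push_cast; ring
  · simp

/-- Decrement a nonzero register. -/
def dec (n i : ℕ) : TProg :=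
  seq (moves .right (i + n)) (seq (scan .right n) (seq (moves .left n)
    (seq (act (fun _ => none) .right)
    (seq (moves .left (1 + n)) (seq (scan .left n) (moves .left i))))))

theorem doesR_dec {i : ℕ} (hi : i < n) (w : List Bool) (σ : ℕ → ℕ) (hσ : σ i ≠ 0) :
    DoesR n (dec n i) w σ w (Function.update σ i (σ i - 1)) := by
  obtain ⟨k, hk⟩ := Nat.exists_eq_succ_of_ne_zero hσ
  refine ((does_right _ _ _).cast rfl rfl rfl ?_).seq ((does_scan_up hi w σ).seq
    (((does_left _ _ _).cast rfl rfl rfl (?_ : _ = (i : ℤ) + (σ i : ℕ) * n)).seq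
    (((does_write_right _ _ _).cast rfl rfl
      (regTape_update_reg (k := σ i - 1) hi w σ (by omega) (by omega)
        (by rw [if_neg (by omega)])) rfl).seq
    (((does_left _ _ _).cast rfl rfl rfl ?_).seq
    ((does_scan_down hi w _ (k := σ i - 1) (by simp)).seq
    ((does_left _ _ _).cast rfl rfl rfl ?_))))))
  · push_cast; ring
  · push_cast; ring
  · rw [hk, Nat.succ_sub_one]; push_cast; ring
  · simp

/-- The body of a loop over a register, started on the first cell of the register. -/
def whileBody (n i : ℕ) (p : TProg) : TProg :=
  seq (moves .left (i + n)) (seq (dec n i) (seq p (moves .right (i + n))))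

/-- The test of a loop over a register, started on the first cell of the register. -/
def whileTest (n i : ℕ) (p : TProg) : TProg := loop Option.isSome (whileBody n i p)

/-- As long as a register is not zero, decrement it and run `p`. -/
def whileReg (n i : ℕ) (p : TProg) : TProg :=
  seq (moves .right (i + n)) (seq (whileTest n i p) (moves .left (i + n)))

theorem isSome_regTape {i : ℕ} (hi : i < n) (w : List Bool) (σ : ℕ → ℕ) :
    (regTape n w σ (i + n)).isSome = decide (σ i ≠ 0) := by
  have := regTape_block hi w σ 1
  rw [Nat.cast_one, one_mul] at this
  rw [this]
  by_cases h : σ i = 0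
  · simp [h]
  · rw [if_pos ⟨one_pos, by omega⟩]
    simp [h]

theorem does_whileTest_zero {i : ℕ} (hi : i < n) (p : TProg) (w : List Bool) {σ : ℕ → ℕ}
    (h : σ i = 0) : Does (whileTest n i p) (regTape n w σ) (i + n) (regTape n w σ) (i + n) :=
  does_loop_done _ (by rw [isSome_regTape hi]; simp [h])

theorem does_to_cell (i : ℕ) (T : ℤ → Option Bool) :
    Does (moves .right (i + n)) T 0 T (i + n) :=
  (does_right _ _ _).cast rfl rfl rfl (by push_cast; ring)

theorem does_from_cell (i : ℕ) (T : ℤ → Option Bool) :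
    Does (moves .left (i + n)) T (i + n) T 0 :=
  (does_left _ _ _).cast rfl rfl rfl (by push_cast; ring)

theorem reaches_seq (p q : TProg) (K : List TProg) (T : ℤ → Option Bool) (h : ℤ) :
    State.Reaches ⟨seq p q :: K, false, T, h⟩ ⟨p :: q :: K, false, T, h⟩ :=
  reaches_stay fun _ => rfl

theorem reaches_whileTest {i : ℕ} (hi : i < n) (p : TProg) (w : List Bool) {σ : ℕ → ℕ}
    (h : σ i ≠ 0) (K : List TProg) :
    State.Reaches ⟨whileTest n i p :: K, false, regTape n w σ, i + n⟩
      ⟨p :: moves .right (i + n) :: whileTest n i p :: K, false,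
        regTape n w (Function.update σ i (σ i - 1)), 0⟩ :=
  (reaches_loop _ _ (by rw [isSome_regTape hi]; simp [h])).trans <|
    (reaches_seq _ _ _ _ _).trans <| (does_from_cell i _ _).trans <|
    (reaches_seq _ _ _ _ _).trans <| (doesR_dec hi w σ h _).trans <| reaches_seq _ _ _ _ _

theorem does_whileTest_succ {i : ℕ} (hi : i < n) {p : TProg} {w w' : List Bool}
    {σ σ' : ℕ → ℕ} (h : σ i ≠ 0) (hp : DoesR n p w (Function.update σ i (σ i - 1)) w' σ')
    {T : ℤ → Option Bool} {k : ℤ} (hw : Does (whileTest n i p) (regTape n w' σ') (i + n) T k) :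
    Does (whileTest n i p) (regTape n w σ) (i + n) T k := fun K =>
  (reaches_whileTest hi p w h K).trans <| (hp _).trans <| (does_to_cell i _ _).trans (hw K)

/-- A loop whose states are `(W 0, S 0), (W 1, S 1), …`, ended after `m` rounds. -/
theorem doesR_whileReg {i : ℕ} (hi : i < n) {p : TProg} (m : ℕ) (W : ℕ → List Bool)
    (S : ℕ → ℕ → ℕ) (hm : S m i = 0) (hS : ∀ r < m, S r i ≠ 0)
    (hp : ∀ r < m, DoesR n p (W r) (Function.update (S r) i (S r i - 1)) (W (r + 1)) (S (r + 1))) :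
    DoesR n (whileReg n i p) (W 0) (S 0) (W m) (S m) := by
  refine (does_to_cell i _).seq (Does.seq ?_ (does_from_cell i _))
  suffices h : ∀ r ≤ m, Does (whileTest n i p) (regTape n (W (m - r)) (S (m - r))) (i + n)
      (regTape n (W m) (S m)) (i + n) by simpa using h m le_rfl
  intro r hr
  induction r with
  | zero => exact does_whileTest_zero hi p _ hm
  | succ r ih =>
    have e : m - (r + 1) + 1 = m - r := by omega
    have := hp (m - (r + 1)) (by omega)
    rw [e] at this
    exact does_whileTest_succ hi (hS _ (by omega)) this (ih (by omega))

/-- Branching on whether a register is nonzero. -/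
def ifReg (n i : ℕ) (p q : TProg) : TProg :=
  seq (moves .right (i + n)) (ite Option.isSome (seq (moves .left (i + n)) p)
    (seq (moves .left (i + n)) q))

theorem DoesR.ifReg_pos {i : ℕ} (hi : i < n) {p : TProg} (q : TProg) {w w' : List Bool}
    {σ σ' : ℕ → ℕ} (h : σ i ≠ 0) (hp : DoesR n p w σ w' σ') : DoesR n (ifReg n i p q) w σ w' σ' :=
  (does_to_cell i _).seq (.ite_true _ (by rw [isSome_regTape hi]; simp [h])
    ((does_from_cell i _).seq hp))

theorem DoesR.ifReg_neg {i : ℕ} (hi : i < n) (p : TProg) {q : TProg} {w w' : List Bool}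
    {σ σ' : ℕ → ℕ} (h : σ i = 0) (hq : DoesR n q w σ w' σ') : DoesR n (ifReg n i p q) w σ w' σ' :=
  (does_to_cell i _).seq (.ite_false _ (by rw [isSome_regTape hi]; simp [h])
    ((does_from_cell i _).seq hq))

/-! ### The stack -/

theorem regTape_neg (w : List Bool) (σ : ℕ → ℕ) (k : ℕ) :
    regTape n w σ (-1 - k) = w.reverse[k]? := by
  rw [show (-1 - k : ℤ) = Int.negSucc k by rw [Int.negSucc_eq]; ring]
  rfl

theorem regTape_zero (w : List Bool) (σ : ℕ → ℕ) : regTape n w σ 0 = none := by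
  show regTape n w σ ((0 : ℕ) : ℤ) = none
  rw [regTape_natCast]
  simp

theorem regTape_update_stack (w : List Bool) (σ : ℕ → ℕ) (b : Bool) :
    Function.update (regTape n w σ) (-1 - w.length) (some b) = regTape n (b :: w) σ := by
  funext z
  rcases z with k | k
  · rw [Function.update_of_ne (by simp only [Int.ofNat_eq_natCast]; omega)]
    rfl
  · rw [show Int.negSucc k = -1 - (k : ℤ) by rw [Int.negSucc_eq]; ring, regTape_neg]
    by_cases hk : k = w.length
    · subst hk
      simp
    · rw [Function.update_of_ne (by omega), regTape_neg, List.reverse_cons]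
      rcases lt_or_gt_of_ne hk with h | h
      · rw [List.getElem?_append_left (by simpa)]
      · rw [List.getElem?_eq_none (by simp; omega), List.getElem?_eq_none (by simp; omega)]

theorem regTape_update_stack_none (w : List Bool) (σ : ℕ → ℕ) (b : Bool) :
    Function.update (regTape n (b :: w) σ) (-1 - w.length) none = regTape n w σ := by
  rw [← regTape_update_stack, Function.update_idem, Function.update_eq_self_iff, regTape_neg]
  simp

theorem does_scan_stack_left (w : List Bool) (σ : ℕ → ℕ) :
    Does (seq (moves .left 1) (scan .left 1)) (regTape n w σ) 0 (regTape n w σ)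
      (-1 - w.length) := by
  have e : ∀ j : ℕ, (0 : ℤ) - (1 : ℕ) + j * ((1 : ℕ) * shift .left) = -1 - j :=
    fun j => by simp only [shift]; push_cast; ring
  refine (does_left _ _ _).seq
    ((does_scan .left 1 w.length _ _ (fun j hj => ?_) ?_).cast rfl rfl rfl (e _))
  · rw [e, regTape_neg]
    simp [hj]
  · rw [e, regTape_neg]
    simp

theorem does_scan_stack_right (w : List Bool) (σ : ℕ → ℕ) {k : ℕ} (hk : k ≤ w.length) :
    Does (scan .right 1) (regTape n w σ) (-k) (regTape n w σ) 0 := by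
  have e : ∀ j : ℕ, j ≤ k → -(k : ℤ) + j * ((1 : ℕ) * shift .right) = -(k - j : ℕ) :=
    fun j hj => by simp only [shift]; push_cast [hj]; ring
  refine (does_scan .right 1 k _ _ (fun j hj => ?_) ?_).cast rfl rfl rfl
    (by rw [e _ le_rfl]; simp)
  · rw [e j hj.le, show (-(k - j : ℕ) : ℤ) = -1 - (k - j - 1 : ℕ) by omega,
      regTape_neg, List.getElem?_eq_getElem (by simp; omega)]
    rfl
  · rw [e _ le_rfl]
    simpa using regTape_zero w σ

/-- Push a symbol on the stack. -/
def push (b : Bool) : TProg :=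
  seq (seq (moves .left 1) (scan .left 1))
    (seq (act (fun _ => some b) .right) (scan .right 1))

theorem doesR_push (b : Bool) (w : List Bool) (σ : ℕ → ℕ) :
    DoesR n (push b) w σ (b :: w) σ := by
  refine (does_scan_stack_left w σ).seq (((does_write_right _ _ _).cast rfl rfl
    (regTape_update_stack w σ b) rfl).seq ?_)
  exact (does_scan_stack_right (b :: w) σ (Nat.le_succ _)).cast rfl (by ring) rfl rfl

/-- Pop a symbol from the stack and branch on it. -/
def pop (p₀ pf pt : TProg) : TProg :=
  seq (seq (moves .left 1) (scan .left 1)) (seq (moves .right 1)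
    (ite Option.isNone p₀ (ite (fun a => decide (a = some true))
      (seq (act (fun _ => none) .right) (seq (scan .right 1) pt))
      (seq (act (fun _ => none) .right) (seq (scan .right 1) pf)))))

theorem DoesR.pop_nil {p₀ : TProg} (pf pt : TProg) {w' : List Bool} {σ σ' : ℕ → ℕ}
    (h : DoesR n p₀ [] σ w' σ') : DoesR n (pop p₀ pf pt) [] σ w' σ' :=
  (does_scan_stack_left [] σ).seq (((does_right _ _ _).cast rfl rfl rfl (by simp)).seq
    (.ite_true _ (by rw [regTape_zero]; rfl) h))

theorem DoesR.pop_cons (p₀ : TProg) {pf pt : TProg} {b : Bool} {w w' : List Bool} {σ σ' : ℕ → ℕ}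
    (h : DoesR n (if b then pt else pf) w σ w' σ') : DoesR n (pop p₀ pf pt) (b :: w) σ w' σ' := by
  have hb : regTape n (b :: w) σ (-1 - w.length) = some b := by
    rw [regTape_neg]
    simp
  have key : ∀ p, DoesR n p w σ w' σ' → Does (TProg.seq (act (fun _ => none) .right)
      (TProg.seq (scan .right 1) p)) (regTape n (b :: w) σ) (-1 - w.length) (regTape n w' σ') 0 :=
    fun p hp => ((does_write_right _ _ _).cast rfl rfl (regTape_update_stack_none w σ b)
      (by ring)).seq ((does_scan_stack_right w σ le_rfl).seq hp)
  have e : (-1 - (b :: w).length + (1 : ℕ) : ℤ) = -1 - w.length := by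
    rw [List.length_cons]
    push_cast
    ring
  refine (does_scan_stack_left _ σ).seq (((does_right _ _ _).cast rfl rfl rfl e).seq
    (.ite_false _ (by rw [hb]; rfl) ?_))
  cases b
  · exact .ite_false _ (by rw [hb]; rfl) (key _ h)
  · exact .ite_true _ (by rw [hb]; rfl) (key _ h)

end TProg

/-! ### Compiling primitive recursive functions -/

namespace TProg

variable {n : ℕ}

/-- Set a register to zero. -/
def clear (n i : ℕ) : TProg := whileReg n i skip

theorem doesR_clear {i : ℕ} (hi : i < n) (w : List Bool) (σ : ℕ → ℕ) :
    DoesR n (clear n i) w σ w (Function.update σ i 0) := by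
  refine (doesR_whileReg hi (σ i) (fun _ => w) (fun r => Function.update σ i (σ i - r))
    (by simp) (fun r hr => ?_) fun r hr => (doesR_skip w _).cast rfl rfl rfl ?_).cast
    rfl ?_ rfl ?_
  · rw [Function.update_self]
    omega
  · funext j
    simp only [Function.update_apply]
    grind
  · simp
  · simp

/-- Add the register `i` to the register `o`, using the zero register `t`. -/
def copy (n i t o : ℕ) : TProg :=
  seq (whileReg n i (seq (inc n o) (inc n t))) (whileReg n t (inc n i))

theorem doesR_copy {i t o : ℕ} (hi : i < n) (ht : t < n) (ho : o < n) (hio : i ≠ o) (hit : i ≠ t)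
    (hto : t ≠ o) (w : List Bool) {σ : ℕ → ℕ} (hσ : σ t = 0) :
    DoesR n (copy n i t o) w σ w (Function.update σ o (σ o + σ i)) := by
  let S : ℕ → ℕ → ℕ := fun r =>
    Function.update (Function.update (Function.update σ i (σ i - r)) o (σ o + r)) t r
  let R : ℕ → ℕ → ℕ := fun r =>
    Function.update (Function.update (Function.update σ i r) o (σ o + σ i)) t (σ i - r)
  have h1 : DoesR n (whileReg n i (TProg.seq (inc n o) (inc n t))) w (S 0) w (S (σ i)) := by
    refine doesR_whileReg hi (σ i) (fun _ => w) S ?_ (fun r hr => ?_) fun r hr =>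
      ((doesR_inc ho w _).seq (doesR_inc ht w _)).cast rfl rfl rfl ?_
    · simp only [S, Function.update_apply]
      grind
    · simp only [S, Function.update_apply]
      grind
    · funext j
      simp only [S, Function.update_apply]
      grind
  have h2 : DoesR n (whileReg n t (inc n i)) w (R 0) w (R (σ i)) := by
    refine doesR_whileReg ht (σ i) (fun _ => w) R ?_ (fun r hr => ?_) fun r hr =>
      (doesR_inc hi w _).cast rfl rfl rfl ?_
    · simp only [R, Function.update_apply]
      grind
    · simp only [R, Function.update_apply]
      grind
    · funext j
      simp only [R, Function.update_apply]
      grind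
  refine (h1.seq (h2.cast rfl ?_ rfl rfl)).cast rfl ?_ rfl ?_ <;>
  · funext j
    simp only [S, R, Function.update_apply]
    grind

/-- Clear `k` registers from `s` on. -/
theorem exists_clear_range (s k : ℕ) (h : s + k ≤ n) : ∃ p, ∀ w σ,
    DoesR n p w σ w fun j => if s ≤ j ∧ j < s + k then 0 else σ j := by
  induction k with
  | zero =>
    refine ⟨skip, fun w σ => (doesR_skip w σ).cast rfl rfl rfl ?_⟩
    funext j
    rw [if_neg (by omega)]
  | succ k ih =>
    obtain ⟨p, hp⟩ := ih (by omega)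
    refine ⟨seq p (clear n (s + k)), fun w σ =>
      ((hp w σ).seq (doesR_clear (by omega) w _)).cast rfl rfl rfl ?_⟩
    funext j
    simp only [Function.update_apply]
    grind

/-- Programs compute `f` from the registers `loc` to the register `o`, with all registers from `s`
on as scratch space, provided that there are enough registers. -/
def Computes {a : ℕ} (f : List.Vector ℕ a → ℕ) : Prop :=
  ∃ m, ∀ n s (loc : Fin a → ℕ) o, (∀ i, loc i < s) → o < s → (∀ i, loc i ≠ o) → s + m ≤ n →
    ∃ p, ∀ w σ, σ o = 0 → (∀ j, s ≤ j → σ j = 0) →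
      DoesR n p w σ w (Function.update σ o (f (List.Vector.ofFn fun i => σ (loc i))))

theorem computes_zero : Computes fun _ : List.Vector ℕ 0 => 0 := by
  refine ⟨0, fun n s loc o _ _ _ _ => ⟨skip, fun w σ hσ _ => ?_⟩⟩
  refine (doesR_skip w σ).cast rfl rfl rfl ?_
  exact (Function.update_eq_self_iff.2 hσ.symm).symm

theorem computes_get {a : ℕ} (i : Fin a) : Computes fun v : List.Vector ℕ a => v.get i := by
  refine ⟨1, fun n s loc o hl ho hlo hn => ⟨copy n (loc i) s o, fun w σ hσ hs => ?_⟩⟩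
  have := hl i
  refine (doesR_copy (by omega) (by omega) (by omega) (hlo i) (by omega) (by omega) w
    (hs s le_rfl)).cast rfl rfl rfl ?_
  simp only [hσ, zero_add, List.Vector.get_ofFn]

theorem computes_succ : Computes fun v : List.Vector ℕ 1 => v.head.succ := by
  refine ⟨1, fun n s loc o hl ho hlo hn =>
    ⟨seq (copy n (loc 0) s o) (inc n o), fun w σ hσ hs => ?_⟩⟩
  have := hl 0
  refine ((doesR_copy (by omega) (by omega) (by omega) (hlo 0) (by omega) (by omega) w
    (hs s le_rfl)).seq (doesR_inc (by omega) w _)).cast rfl rfl rfl ?_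
  rw [hσ, zero_add, Function.update_idem, Function.update_self]
  rfl

theorem exists_computes_range {a k : ℕ} {g : ℕ → List.Vector ℕ a → ℕ}
    (hg : ∀ i < k, Computes (g i)) : ∃ m, ∀ n s (loc : Fin a → ℕ), (∀ i, loc i < s) →
      s + m ≤ n → ∃ p, ∀ w σ, (∀ j, s ≤ j → σ j = 0) →
        DoesR n p w σ w fun j => if s ≤ j ∧ j < s + k then
          g (j - s) (List.Vector.ofFn fun i => σ (loc i)) else σ j := by
  induction k with
  | zero =>
    refine ⟨0, fun n s loc _ _ => ⟨skip, fun w σ _ => (doesR_skip w σ).cast rfl rfl rfl ?_⟩⟩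
    funext j
    rw [if_neg (by omega)]
  | succ k ih =>
    obtain ⟨m, hm⟩ := ih fun i hi => hg i (by omega)
    obtain ⟨m', hm'⟩ := hg k (by omega)
    refine ⟨m + (k + 1 + m'), fun n s loc hl hn => ?_⟩
    obtain ⟨p, hp⟩ := hm n s loc hl (by omega)
    obtain ⟨q, hq⟩ := hm' n (s + (k + 1)) loc (s + k) (fun i => by have := hl i; omega) (by omega)
      (fun i => by have := hl i; omega) (by omega)
    refine ⟨seq p q, fun w σ hσ => ((hp w σ hσ).seq (hq w _ ?_ fun j hj => ?_)).cast
      rfl rfl rfl ?_⟩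
    · rw [if_neg (by omega), hσ _ (by omega)]
    · rw [if_neg (by omega), hσ _ (by omega)]
    · have e : (fun i => if s ≤ loc i ∧ loc i < s + k then
          g (loc i - s) (List.Vector.ofFn fun i => σ (loc i)) else σ (loc i)) =
          fun i => σ (loc i) := by
        funext i
        rw [if_neg (by have := hl i; omega)]
      rw [e]
      funext j
      simp only [Function.update_apply]
      by_cases hj : j = s + k
      · subst hj
        rw [if_pos rfl, if_pos (by omega), Nat.add_sub_cancel_left]
      · rw [if_neg hj]
        by_cases h : s ≤ j ∧ j < s + k
        · rw [if_pos h, if_pos (by omega)]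
        · rw [if_neg h, if_neg (by omega)]

theorem Computes.comp {a k : ℕ} {f : List.Vector ℕ k → ℕ} {g : Fin k → List.Vector ℕ a → ℕ}
    (hf : Computes f) (hg : ∀ i, Computes (g i)) :
    Computes fun v => f (List.Vector.ofFn fun i => g i v) := by
  obtain ⟨m, hm⟩ := hf
  obtain ⟨m', hm'⟩ := exists_computes_range (k := k)
    (g := fun i v => if h : i < k then g ⟨i, h⟩ v else 0) fun i hi => by simpa [hi] using hg ⟨i, hi⟩
  refine ⟨k + m + m', fun n s loc o hl ho hlo hn => ?_⟩
  obtain ⟨p, hp⟩ := hm' n s loc hl (by omega)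
  obtain ⟨q, hq⟩ := hm n (s + k) (fun i => s + i) o (fun i => by omega) (by omega)
    (fun i => by omega) (by omega)
  obtain ⟨r, hr⟩ := exists_clear_range (n := n) s k (by omega)
  refine ⟨seq p (seq q r), fun w σ hσ hs => ((hp w σ hs).seq ((hq w _ ?_ fun j hj => ?_).seq
    (hr w _))).cast rfl rfl rfl ?_⟩
  · rw [if_neg (by omega), hσ]
  · rw [if_neg (by omega), hs _ (by omega)]
  · have e : (fun i : Fin k => if s ≤ s + (i : ℕ) ∧ s + (i : ℕ) < s + k then
        (if h : s + (i : ℕ) - s < k then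
          g ⟨s + i - s, h⟩ (List.Vector.ofFn fun i => σ (loc i)) else 0)
        else σ (s + i)) = fun i => g i (List.Vector.ofFn fun i => σ (loc i)) := by
      funext i
      simp
    rw [e]
    funext j
    simp only [Function.update_apply]
    by_cases hj : j = o
    · subst hj
      rw [if_neg (by omega), if_pos rfl, if_pos rfl]
    · rw [if_neg hj, if_neg hj]
      by_cases h : s ≤ j ∧ j < s + k
      · rw [if_pos h, hs _ h.1]
      · rw [if_neg h, if_neg h]

theorem Computes.prec {a : ℕ} {f : List.Vector ℕ a → ℕ} {g : List.Vector ℕ (a + 2) → ℕ}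
    (hf : Computes f) (hg : Computes g) : Computes fun v : List.Vector ℕ (a + 1) =>
      v.head.rec (f v.tail) fun y IH => g (y ::ᵥ IH ::ᵥ v.tail) := by
  obtain ⟨m, hm⟩ := hf
  obtain ⟨m', hm'⟩ := hg
  refine ⟨5 + m + m', fun n s loc o hl ho hlo hn => ?_⟩
  have hl0 := hl 0
  have hlo0 := hlo 0
  have hls : ∀ i : Fin a, loc i.succ < s := fun i => hl _
  let loc' : Fin (a + 2) → ℕ := Fin.cons (s + 1) (Fin.cons (s + 2) fun i => loc i.succ)
  have hl' : ∀ i, loc' i < s + 3 := by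
    refine Fin.cases ?_ (Fin.cases ?_ fun i => ?_)
    · simp [loc']
    · simp [loc']
    · have := hls i
      simp only [loc', Fin.cons_succ]
      omega
  obtain ⟨p, hp⟩ := hm n (s + 5) (fun i => loc i.succ) (s + 2)
    (fun i => by have := hls i; omega) (by omega) (fun i => by have := hls i; omega) (by omega)
  obtain ⟨q, hq⟩ := hm' n (s + 5) loc' (s + 3) (fun i => by have := hl' i; omega) (by omega)
    (fun i => by have := hl' i; omega) (by omega)
  refine ⟨seq (copy n (loc 0) (s + 1) s) (seq p (seq (whileReg n s (seq q (seq (clear n (s + 2))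
    (seq (copy n (s + 3) (s + 4) (s + 2)) (seq (clear n (s + 3)) (inc n (s + 1)))))))
    (seq (copy n (s + 2) (s + 3) o) (seq (clear n (s + 1)) (clear n (s + 2)))))), ?_⟩
  intro w σ hσ hs
  let v := List.Vector.ofFn fun i : Fin a => σ (loc i.succ)
  let R : ℕ → ℕ := fun r => r.rec (f v) fun y IH => g (y ::ᵥ IH ::ᵥ v)
  let S : ℕ → ℕ → ℕ := fun r j =>
    if j = s then σ (loc 0) - r else if j = s + 1 then r else if j = s + 2 then R r else σ j
  have hs0 := hs s le_rfl
  have hs1 := hs (s + 1) (by omega)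
  have hs2 := hs (s + 2) (by omega)
  have hs3 := hs (s + 3) (by omega)
  have hs4 := hs (s + 4) (by omega)
  have hcopy := doesR_copy (n := n) (i := loc 0) (t := s + 1) (o := s) (by omega) (by omega)
    (by omega) (by omega) (by omega) (by omega) w hs1
  rw [hs0, zero_add] at hcopy
  have hinit := hp w (Function.update σ s (σ (loc 0)))
    (by rw [Function.update_of_ne (by omega), hs2])
    (fun j hj => by rw [Function.update_of_ne (by omega), hs j (by omega)])
  have hv : (List.Vector.ofFn fun i : Fin a => Function.update σ s (σ (loc 0)) (loc i.succ)) = v :=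
    congrArg _ (funext fun i => Function.update_of_ne (by have := hls i; omega) _ _)
  rw [hv] at hinit
  have hloop : DoesR n (whileReg n s (TProg.seq q (TProg.seq (clear n (s + 2))
      (TProg.seq (copy n (s + 3) (s + 4) (s + 2)) (TProg.seq (clear n (s + 3)) (inc n (s + 1)))))))
      w (S 0) w (S (σ (loc 0))) := by
    refine doesR_whileReg (by omega) (σ (loc 0)) (fun _ => w) S (by simp [S]) (fun r hr => ?_)
      fun r hr => ?_
    · simp only [S, if_pos]
      omega
    · have h1 := hq w (Function.update (S r) s (S r s - 1))
        (by rw [Function.update_of_ne (by omega)]; simp [S, hs3])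
        (fun j hj => by
          rw [Function.update_of_ne (by omega)]
          simp only [S]
          rw [if_neg (by omega), if_neg (by omega), if_neg (by omega), hs j (by omega)])
      have hv' : (List.Vector.ofFn fun i : Fin (a + 2) =>
          Function.update (S r) s (S r s - 1) (loc' i)) = r ::ᵥ R r ::ᵥ v := by
        refine congrArg₂ List.Vector.cons ?_ (congrArg₂ List.Vector.cons ?_
          (congrArg _ (funext fun i => ?_)))
        · simp [loc', S]
        · show Function.update (S r) s (S r s - 1) (s + 2) = R r
          simp [S]
        · show Function.update (S r) s (S r s - 1) (loc i.succ) = σ (loc i.succ)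
          have hi := hls i
          rw [Function.update_of_ne (by omega)]
          simp only [S]
          rw [if_neg (by omega), if_neg (by omega), if_neg (by omega)]
      rw [hv'] at h1
      have hR : g (r ::ᵥ R r ::ᵥ v) = R (r + 1) := rfl
      rw [hR] at h1
      refine h1.seq ((doesR_clear (by omega) w _).seq ((doesR_copy (by omega) (by omega)
        (by omega) (by omega) (by omega) (by omega) w ?_).seq ((doesR_clear (by omega) w _).seq
        ((doesR_inc (by omega) w _).cast rfl rfl rfl ?_))))
      · simp [S, hs4]
      · funext j
        simp only [Function.update_apply, S]
        grind
  refine (hcopy.seq (hinit.seq ((hloop.cast rfl ?_ rfl rfl).seq ((doesR_copy (by omega) (by omega)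
    (by omega) (by omega) (by omega) (by omega) w ?_).seq ((doesR_clear (by omega) w _).seq
    (doesR_clear (by omega) w _)))))).cast rfl rfl rfl ?_
  · have hR0 : R 0 = f v := rfl
    funext j
    simp only [Function.update_apply, S]
    grind
  · simp [S, hs3]
  · have e : ((List.Vector.ofFn fun i => σ (loc i)).head.rec
        (f (List.Vector.ofFn fun i => σ (loc i)).tail) fun y IH =>
          g (y ::ᵥ IH ::ᵥ (List.Vector.ofFn fun i => σ (loc i)).tail) : ℕ) = R (σ (loc 0)) := by
      simp only [List.Vector.ofFn, List.Vector.head_cons, List.Vector.tail_cons]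
      rfl
    refine Eq.trans ?_ (congrArg (Function.update σ o) e.symm)
    funext j
    simp only [Function.update_apply, S]
    grind

theorem computes_of_primrec' {a : ℕ} {f : List.Vector ℕ a → ℕ} (hf : Nat.Primrec' f) :
    Computes f := by
  induction hf with
  | zero => exact computes_zero
  | succ => exact computes_succ
  | get i => exact computes_get i
  | comp g _ _ ihf ihg => exact ihf.comp ihg
  | prec _ _ ihf ihg => exact ihf.prec ihg

/-- The registers with `c` in register `0` and `d` in register `1`. -/
def twoReg (c d : ℕ) : ℕ → ℕ
  | 0 => c
  | 1 => d
  | _ => 0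

/-- A program setting register `1` to a primitive recursive function of register `0`. -/
theorem exists_doesR_set {f : ℕ → ℕ} (hf : Primrec f) :
    ∃ m, ∀ n, m ≤ n → ∃ p, ∀ w c, DoesR n p w (twoReg c 0) w (twoReg c (f c)) := by
  obtain ⟨m, hm⟩ := computes_of_primrec' (Nat.Primrec'.prim_iff₁.2 hf)
  refine ⟨m + 2, fun n hn => ?_⟩
  obtain ⟨p, hp⟩ := hm n 2 (fun _ => 0) 1 (by simp) (by simp) (by simp) (by omega)
  refine ⟨p, fun w c => (hp w (twoReg c 0) rfl ?_).cast rfl rfl rfl ?_⟩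
  · rintro (_ | _ | j) hj
    · omega
    · omega
    · rfl
  · funext j
    rcases j with _ | _ | j <;> rfl

/-- A program applying a primitive recursive function to register `0`. -/
theorem exists_doesR_apply {f : ℕ → ℕ} (hf : Primrec f) :
    ∃ m, ∀ n, m ≤ n → ∃ p, ∀ w c, DoesR n p w (twoReg c 0) w (twoReg (f c) 0) := by
  obtain ⟨m, hm⟩ := exists_doesR_set hf
  refine ⟨m + 3, fun n hn => ?_⟩
  obtain ⟨p, hp⟩ := hm n (by omega)
  refine ⟨seq p (seq (clear n 0) (seq (copy n 1 2 0) (clear n 1))), fun w c =>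
    (hp w c).seq ((doesR_clear (by omega) w _).seq ((doesR_copy (by omega) (by omega) (by omega)
      (by omega) (by omega) (by omega) w (by rfl)).seq
      ((doesR_clear (by omega) w _).cast rfl rfl rfl ?_)))⟩
  funext j
  rcases j with _ | _ | j <;> simp [twoReg]

end TProg

/-! ### The bijection between strings and numbers is primitive recursive -/

/-- The code of an element of a primitively encoded type. -/
def code {α : Type} [Primcodable α] (a : α) : ℕ := Encodable.encode a

theorem primrec_code {α : Type} [Primcodable α] : Primrec (code : α → ℕ) := Primrec.encode

theorem strNatEquiv_apply (s : List Bool) :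
    strNatEquiv s =
      ((List.range (code s)).filter (· ∈ Set.range (code : List Bool → ℕ))).length := by
  rw [← List.countP_eq_length_filter]
  have : strNatEquiv s = @List.countP ℕ (fun k => @decide (k ∈ Set.range (code : List Bool → ℕ))
      (Encodable.decidableRangeEncode (List Bool) k)) (List.range (code s)) := rfl
  rw [this]
  congr! 2
  exact decide_eq_decide.2 Iff.rfl

theorem primrec_strNatEquiv : Primrec strNatEquiv :=
  (Primrec.list_length.comp
    ((Primrec.listFilter (Primcodable.mem_range_encode (α := List Bool))).comp
      (Primrec.list_range.comp primrec_code))).of_eq fun s => by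
    rw [strNatEquiv_apply]
    congr!

theorem strNatEquiv_lt {s t : List Bool} (h : code s < code t) : strNatEquiv s < strNatEquiv t := by
  have : strNatEquiv s + 1 ≤ strNatEquiv t := by
    obtain ⟨k, hk⟩ := Nat.exists_eq_add_of_lt h
    rw [strNatEquiv_apply, strNatEquiv_apply, hk, add_right_comm, List.range_add, List.range_succ,
      List.filter_append, List.filter_append, List.length_append, List.length_append]
    simp
  exact this

theorem le_strNatEquiv_replicate (n : ℕ) : n ≤ strNatEquiv (List.replicate n false) := by
  induction n with
  | zero => exact Nat.zero_le _
  | succ n ih =>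
    refine Nat.succ_le_of_lt (ih.trans_lt (strNatEquiv_lt ?_))
    rw [List.replicate_succ]
    exact Nat.lt_succ_of_le (Nat.right_le_pair _ _)

theorem code_symm_le (n : ℕ) : code (strNatEquiv.symm n) ≤ code (List.replicate n false) := by
  by_contra! h
  have := strNatEquiv_lt h
  rw [Equiv.apply_symm_apply] at this
  exact this.not_ge (le_strNatEquiv_replicate n)

theorem primrec_replicate_false : Primrec fun n => List.replicate n false :=
  ((Primrec.list_map Primrec.list_range (Primrec.const false).to₂).of_eq fun n => by simp)

/-- The string coded by a number, if any. -/
def decodeStr (k : ℕ) : Option (List Bool) :=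
  (Primcodable.toEncodable : Encodable (List Bool)).decode k

theorem decodeStr_code (s : List Bool) : decodeStr (code s) = some s := by
  unfold decodeStr code
  exact Encodable.encodek s

theorem primrec_strNatEquiv_symm : Primrec strNatEquiv.symm := by
  have hdec : Primrec decodeStr := Primrec.decode
  have hrel : PrimrecRel fun n k : ℕ => (decodeStr k).map strNatEquiv = some n :=
    Primrec.eq.comp (Primrec.option_map (hdec.comp Primrec.snd)
      (primrec_strNatEquiv.comp Primrec.snd).to₂) (Primrec.option_some.comp Primrec.fst)
  refine (Primrec.option_getD.comp (hdec.comp (Primrec.nat_findGreatest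
    (primrec_code.comp primrec_replicate_false) hrel)) (Primrec.const [])).of_eq fun n => ?_
  have h := Nat.findGreatest_spec (P := fun k => (decodeStr k).map strNatEquiv = some n)
    (code_symm_le n) (by simp [decodeStr_code])
  obtain ⟨s, hs, hn⟩ := Option.map_eq_some_iff.1 h
  rw [hs, ← hn]
  simp

/-! ### Programs on coded data -/

namespace TProg

theorem update_twoReg (c d e : ℕ) : Function.update (twoReg c d) 1 e = twoReg c e := by
  funext j
  rcases j with _ | _ | j <;> simp [twoReg]

/-- A property of programs that holds for some program as soon as there are enough registers. -/
def Programmable (R : ℕ → TProg → Prop) : Prop := ∃ m, ∀ n, m ≤ n → ∃ p, R n p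

variable {α β : Type} [Primcodable α] [Primcodable β]

theorem exists_primrec_code {f : α → ℕ} (hf : Primrec f) :
    ∃ F : ℕ → ℕ, Primrec F ∧ ∀ a, F (code a) = f a :=
  ⟨fun c => ((Encodable.decode c : Option α).map f).getD 0,
    Primrec.option_getD.comp (Primrec.option_map Primrec.decode (hf.comp Primrec.snd).to₂)
      (Primrec.const 0), fun a => by simp [code]⟩

theorem programmable_map {f : α → β} (hf : Primrec f) : Programmable fun n p =>
    ∀ w a, DoesR n p w (twoReg (code a) 0) w (twoReg (code (f a)) 0) := by
  obtain ⟨F, hF, e⟩ := exists_primrec_code (primrec_code.comp hf)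
  obtain ⟨m, hm⟩ := exists_doesR_apply hF
  refine ⟨m, fun n hn => ?_⟩
  obtain ⟨p, hp⟩ := hm n hn
  exact ⟨p, fun w a => e a ▸ hp w (code a)⟩

theorem programmable_test {t : α → Bool} (ht : Primrec t) : Programmable fun n p =>
    ∀ w a, DoesR n p w (twoReg (code a) 0) w (twoReg (code a) (t a).toNat) := by
  obtain ⟨F, hF, e⟩ := exists_primrec_code (α := α) (f := fun a => (t a).toNat)
    ((Primrec.cond ht (Primrec.const 1) (Primrec.const 0)).of_eq fun a => by cases t a <;> rfl)
  obtain ⟨m, hm⟩ := exists_doesR_set hF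
  refine ⟨m, fun n hn => ?_⟩
  obtain ⟨p, hp⟩ := hm n hn
  exact ⟨p, fun w a => e a ▸ hp w (code a)⟩

theorem code_nil : code ([] : List Bool) = 0 := rfl

theorem programmable_read : Programmable fun n p =>
    ∀ s, DoesR n p s (twoReg 0 0) [] (twoReg (code s.reverse) 0) := by
  obtain ⟨m, hm⟩ := programmable_map (f := List.cons false)
    (Primrec.list_cons.comp (Primrec.const false) Primrec.id)
  obtain ⟨m', hm'⟩ := programmable_map (f := List.cons true)
    (Primrec.list_cons.comp (Primrec.const true) Primrec.id)
  refine ⟨m + m' + 2, fun n hn => ?_⟩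
  obtain ⟨p, hp⟩ := hm n (by omega)
  obtain ⟨p', hp'⟩ := hm' n (by omega)
  refine ⟨seq (inc n 1) (whileReg n 1 (pop skip (seq p (inc n 1)) (seq p' (inc n 1)))),
    fun s => ?_⟩
  refine DoesR.seq (σ' := twoReg 0 1) ((doesR_inc (by omega) s _).cast rfl rfl rfl
    (update_twoReg _ _ _)) ((doesR_whileReg (by omega)
    (s.length + 1) (fun r => s.drop r)
    (fun r => twoReg (code (s.take r).reverse) (if r ≤ s.length then 1 else 0)) ?_ ?_ ?_).cast
    ?_ ?_ ?_ ?_)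
  · simp [twoReg]
  · intro r hr
    simp [twoReg, Nat.lt_succ_iff.1 hr]
  · intro r hr
    rw [update_twoReg]
    simp only [if_pos (Nat.lt_succ_iff.1 hr), twoReg, Nat.sub_self]
    rcases Nat.lt_succ_iff_lt_or_eq.1 hr with h | rfl
    · rw [List.drop_eq_getElem_cons h, List.take_succ_eq_append_getElem h, List.reverse_append,
        List.reverse_singleton, List.singleton_append, if_pos (Nat.succ_le_of_lt h)]
      refine DoesR.pop_cons _ ?_
      cases s[r]
      · exact (hp _ _).seq ((doesR_inc (by omega) _ _).cast rfl rfl rfl (update_twoReg _ _ _))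
      · exact (hp' _ _).seq ((doesR_inc (by omega) _ _).cast rfl rfl rfl (update_twoReg _ _ _))
    · simp only [List.drop_length]
      refine (DoesR.pop_nil _ _ (doesR_skip _ _)).cast rfl rfl ?_ ?_ <;>
        simp [List.take_of_length_le]
  · rfl
  · simp [code_nil]
  · simp
  · simp [List.take_of_length_le]

theorem programmable_write : Programmable fun n p =>
    ∀ w l, DoesR n p w (twoReg (code (l : List Bool)) 0) (l.reverse ++ w) (twoReg 0 0) := by
  obtain ⟨m, hm⟩ := programmable_map (Primrec.list_tail (α := Bool))
  obtain ⟨m', hm'⟩ := programmable_test (t := fun l : List Bool => l.head?.isSome)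
    (Primrec.option_isSome.comp Primrec.list_head?)
  obtain ⟨m'', hm''⟩ := programmable_test (t := fun l : List Bool => l.head?.getD false)
    (Primrec.option_getD.comp Primrec.list_head? (Primrec.const false))
  refine ⟨m + m' + m'' + 2, fun n hn => ?_⟩
  obtain ⟨p, hp⟩ := hm n (by omega)
  obtain ⟨q, hq⟩ := hm' n (by omega)
  obtain ⟨r, hr⟩ := hm'' n (by omega)
  refine ⟨seq q (whileReg n 1 (seq (seq r (ifReg n 1 (seq (dec n 1) (push true)) (push false)))
    (seq p q))), fun w l => (hq w l).seq ((doesR_whileReg (by omega) l.length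
    (fun k => (l.take k).reverse ++ w)
    (fun k => twoReg (code (l.drop k)) (l.drop k).head?.isSome.toNat) ?_ ?_ ?_).cast
    ?_ ?_ ?_ ?_)⟩
  · simp [twoReg]
  · intro k hk
    simp [twoReg, hk]
  · intro k hk
    refine DoesR.seq (w' := (l.take (k + 1)).reverse ++ w) (σ' := twoReg (code (l.drop k)) 0) ?_
      ((hp _ _).seq ((hq _ _).cast rfl rfl rfl ?_))
    · refine DoesR.seq ((hr _ (l.drop k)).cast rfl ?_ rfl rfl) ?_
      · rw [update_twoReg]
        simp [twoReg, hk]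
      · rw [List.take_succ_eq_append_getElem hk, List.reverse_append,
          List.reverse_singleton, List.singleton_append, List.drop_eq_getElem_cons hk]
        cases l[k]
        · exact .ifReg_neg (by omega) _ rfl (doesR_push _ _ _)
        · exact .ifReg_pos (by omega) _ (by simp [twoReg]) (((doesR_dec (by omega) _ _
            (by simp [twoReg])).cast rfl rfl rfl (update_twoReg _ _ _)).seq (doesR_push _ _ _))
    · simp
  · simp
  · simp
  · simp
  · simp [code_nil]

end TProg

/-! ### Machines for primitive recursive experiments -/

namespace TProg

variable {n : ℕ}

theorem regTape_input (w : List Bool) (i : ℕ) :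
    regTape n w (twoReg 0 0) (-w.length + i) = w[i]? := by
  by_cases h : i < w.length
  · rw [show (-w.length + i : ℤ) = -1 - (w.length - 1 - i : ℕ) by omega, regTape_neg,
      List.getElem?_reverse (by omega)]
    congr 1
    omega
  · rw [show (-w.length + i : ℤ) = (i - w.length : ℕ) by omega, regTape_natCast,
      List.getElem?_eq_none (by omega), if_neg]
    rcases (i - w.length) % n with _ | _ | j <;> simp only [twoReg] <;> omega

theorem sim_initConf (p : TProg) (s : List Bool) :
    Sim (initConf p.machine s) ⟨[p], false, regTape n s (twoReg 0 0), -s.length⟩ := by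
  have h0 := regTape_input (n := n) s 0
  have hr : ∀ i : ℕ, regTape n s (twoReg 0 0) (-s.length + 1 + i) = s[i + 1]? := fun i => by
    rw [← regTape_input (n := n)]
    congr 1
    push_cast
    ring
  have hl : ∀ i : ℕ, regTape n s (twoReg 0 0) (-s.length - 1 - i) = none := fun i => by
    rw [show (-s.length - 1 - i : ℤ) = -1 - (s.length + i : ℕ) by push_cast; ring, regTape_neg,
      List.getElem?_eq_none (by simp)]
  simp only [Nat.cast_zero, add_zero] at h0
  cases s with
  | nil => exact ⟨rfl, rfl, h0.symm, fun i => (hl i).symm, fun i => (hr i).symm⟩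
  | cons a v =>
    refine ⟨rfl, rfl, h0.symm, fun i => (hl i).symm, fun i => ?_⟩
    refine Eq.trans ?_ (hr i).symm
    simp only [initConf, List.getElem?_map, List.getElem?_cons_succ]
    cases v[i]? <;> rfl

theorem filterMap_id_eq {A : Type} (l : List (Option A)) (v : List A)
    (h : ∀ i : ℕ, l[i]?.getD none = v[i]?) : l.filterMap id = v := by
  induction l generalizing v with
  | nil =>
    cases v with
    | nil => rfl
    | cons b v => simpa using h 0
  | cons a l ih =>
    have h0 := h 0
    have h1 := fun i => h (i + 1)
    cases v with
    | nil =>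
      obtain rfl : a = none := by simpa using h0
      exact ih [] fun i => by simpa using h1 i
    | cons b v =>
      obtain rfl : a = some b := by simpa using h0
      exact congrArg (List.cons b) (ih v fun i => by simpa using h1 i)

theorem Sim.outStr_eq {p : TProg} {c : Conf p.machine} {K : List TProg} {u : Bool} {o : List Bool}
    (h : Sim c ⟨K, u, regTape n o (twoReg 0 0), 0⟩) : outStr c = o := by
  have hl : c.left.filterMap id = o.reverse := filterMap_id_eq _ _ fun i => by
    rw [h.left, ← regTape_neg (n := n) o (twoReg 0 0)]
    rfl
  have hr : c.right.filterMap id = [] := filterMap_id_eq _ _ fun i => by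
    rw [h.right]
    have := regTape_input (n := n) o (o.length + 1 + i)
    rw [List.getElem?_eq_none (by omega)] at this
    rw [List.getElem?_nil, ← this]
    show regTape n o (twoReg 0 0) (0 + 1 + i) = _
    congr 1
    push_cast
    ring
  have hs : c.scan = none := h.scan.trans (regTape_zero o _)
  rw [outStr, List.filterMap_append, List.filterMap_cons, hr, hs, List.filterMap_reverse, hl]
  simp

/-- A primitive recursive experiment, whose result depends on the input and on coin flips (latest
first) made until it is defined, is performed by a machine. -/
theorem exists_IOfun_eq_iSup_runVal {E : List Bool → List Bool → Option (List Bool)}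
    (hE : Primrec₂ E) :
    ∃ M : PTM Bool, ∀ s y, IOfun M s y = ⨆ n, runVal (E s) y n [] := by
  have hE' : Primrec fun a : List Bool × List Bool => E a.1 a.2 := hE
  obtain ⟨m₁, h₁⟩ := programmable_read
  obtain ⟨m₂, h₂⟩ := programmable_map (f := fun l : List Bool => (l.reverse, ([] : List Bool)))
    (Primrec.list_reverse.pair (Primrec.const []))
  obtain ⟨m₃, h₃⟩ := programmable_test
    (t := fun a : List Bool × List Bool => !(E a.1 a.2).isSome)
    (Primrec.not.comp (Primrec.option_isSome.comp hE'))
  have hc : ∀ b, Programmable fun n p => ∀ w (a : List Bool × List Bool),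
      DoesR n p w (twoReg (code a) 0) w (twoReg (code (a.1, b :: a.2)) 0) := fun b =>
    programmable_map (f := fun a : List Bool × List Bool => (a.1, b :: a.2))
      (Primrec.fst.pair (Primrec.list_cons.comp (Primrec.const b) Primrec.snd))
  obtain ⟨m₄, h₄⟩ := hc false
  obtain ⟨m₅, h₅⟩ := hc true
  obtain ⟨m₆, h₆⟩ := programmable_map
    (f := fun a : List Bool × List Bool => ((E a.1 a.2).getD []).reverse)
    (Primrec.list_reverse.comp (Primrec.option_getD.comp hE' (Primrec.const [])))
  obtain ⟨m₇, h₇⟩ := programmable_write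
  set n := m₁ + m₂ + m₃ + m₄ + m₅ + m₆ + m₇ + 2 with hn
  clear_value n
  have h1n : 1 < n := by omega
  obtain ⟨read, hread⟩ := h₁ n (by omega)
  obtain ⟨start, hstart⟩ := h₂ n (by omega)
  obtain ⟨test, htest⟩ := h₃ n (by omega)
  obtain ⟨record₀, hrecord₀⟩ := h₄ n (by omega)
  obtain ⟨record₁, hrecord₁⟩ := h₅ n (by omega)
  obtain ⟨finish, hfinish⟩ := h₆ n (by omega)
  obtain ⟨write, hwrite⟩ := h₇ n (by omega)
  let body : TProg := seq (coin record₀ record₁) test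
  let P : TProg := seq (scan .right 1) (seq read (seq start (seq test
    (seq (whileReg n 1 body) (seq finish write)))))
  refine ⟨P.machine, fun s y => ?_⟩
  let a : List Bool → State := fun w =>
    ⟨[whileTest n 1 body, moves .left (1 + n), seq finish write], false,
      regTape n [] (twoReg (code (s, w)) (!(E s w).isSome).toNat), (1 : ℕ) + n⟩
  have hinit : State.Reaches ⟨[P], false, regTape n s (twoReg 0 0), -s.length⟩ (a []) :=
    (reaches_seq _ _ _ _ _).trans <| (does_scan_stack_right s _ le_rfl _).trans <|
    (reaches_seq _ _ _ _ _).trans <| (hread s _).trans <|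
    (reaches_seq _ _ _ _ _).trans <| (((hstart [] s.reverse).cast rfl rfl rfl
      (by rw [List.reverse_reverse])) _).trans <|
    (reaches_seq _ _ _ _ _).trans <| (htest [] (s, []) _).trans <|
    (reaches_seq _ _ _ _ _).trans <| (reaches_seq _ _ _ _ _).trans <|
    (does_to_cell 1 _ _).trans (reaches_seq _ _ _ _ _)
  obtain ⟨c, hsim, hd⟩ := (sim_initConf P s).exists_delays hinit
  rw [IOfun, hd.1]
  refine lfpFm_eq_iSup_runVal (fun w o h => ?_) (fun w h => ?_) hsim y
  · refine ⟨regTape n o (twoReg 0 0), 0, ?_, fun c hc => hc.outStr_eq⟩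
    have hw : DoesR n write [] (twoReg (code ((E s w).getD []).reverse) 0) o (twoReg 0 0) :=
      (hwrite [] _).cast rfl rfl (by simp [h]) rfl
    exact (does_whileTest_zero h1n body [] (by simp [twoReg, h]) _).trans <|
      (does_from_cell 1 _ _).trans <| (reaches_seq _ _ _ _ _).trans <|
      (((hfinish [] (s, w)).cast rfl (by simp [h]) rfl rfl) _).trans (hw [])
  · have hgo : ∀ b, State.Reaches ⟨(if b then record₁ else record₀) :: test ::
        moves .right (1 + n) :: (a w).stack, true, regTape n [] (twoReg (code (s, w)) 0), 0 + 1⟩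
        (a (b :: w)) := fun b => by
      refine (reaches_undo _ _ _).trans <| Relation.ReflTransGen.trans ?_ <|
        (htest [] (s, b :: w) _).trans <| does_to_cell 1 _ _
      cases b
      · exact hrecord₀ [] (s, w) _
      · exact hrecord₁ [] (s, w) _
    refine ⟨record₀, record₁, test :: moves .right (1 + n) :: (a w).stack,
      regTape n [] (twoReg (code (s, w)) 0), 0, ?_, hgo false, hgo true⟩
    have := (reaches_whileTest h1n body [] (σ := twoReg (code (s, w)) (!(E s w).isSome).toNat)
      (by simp [twoReg, h]) [moves .left (1 + n), seq finish write]).trans (reaches_seq _ _ _ _ _)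
    have e : twoReg (code (s, w)) (!(E s w).isSome).toNat 1 - 1 = 0 := by simp [twoReg, h]
    rw [update_twoReg, e] at this
    exact this

end TProg

namespace Sampler

theorem runVal_eq_toReal_approx (S : Sampler ℕ) (y : ℕ) (n : ℕ) (w : List Bool) :
    TProg.runVal (fun w => (S w.reverse).map fun r => strNatEquiv.symm r.1) (strNatEquiv.symm y)
      n w = (approx n (fun c => S (w.reverse ++ c)) y).toReal := by
  induction n generalizing w with
  | zero => simp [TProg.runVal, approx]
  | succ n ih =>
    cases h : S w.reverse with
    | some r =>
      rw [TProg.runVal_some (o := strNatEquiv.symm r.1) (by simp [h])]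
      simp only [approx, List.append_nil, h, EmbeddingLike.apply_eq_iff_eq]
      split_ifs <;> simp
    | none =>
      have e : ∀ b : Bool, (fun c => S ((b :: w).reverse ++ c)) =
          Sampler.deriv (fun c => S (w.reverse ++ c)) b := fun b => by
        funext c
        simp [Sampler.deriv]
      have ht : ∀ T : Sampler ℕ, (2⁻¹ * approx n T y) ≠ ⊤ := fun T =>
        ENNReal.mul_ne_top (by simp) ((approx_le_one n T y).trans_lt ENNReal.one_lt_top).ne
      rw [TProg.runVal_none (by simp [h]), ih, ih, e, e]
      simp only [approx, List.append_nil, h]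
      rw [ENNReal.toReal_add (ht _) (ht _)]
      simp

theorem PCfun_of_samples {S : List ℕ → Sampler ℕ} {f : (Fin 1 → ℕ) → ℕ → ℝ} (h : Samples S f) :
    PCfun f := by
  obtain ⟨M, hM⟩ := TProg.exists_IOfun_eq_iSup_runVal
    (E := fun s w => (S [strNatEquiv s] w.reverse).map fun r => strNatEquiv.symm r.1)
    (Primrec.option_map (h.primrec.comp (Primrec.list_cons.comp
      (primrec_strNatEquiv.comp Primrec.fst) (Primrec.const []))
      (Primrec.list_reverse.comp Primrec.snd))
      (primrec_strNatEquiv_symm.comp (Primrec.fst.comp Primrec.snd)).to₂)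
  refine ⟨M, fun x y => ?_⟩
  rw [hM, h.eq_den, den_eq_iSup (h.good _), ENNReal.toReal_iSup fun n =>
    ((approx_le_one n _ y).trans_lt ENNReal.one_lt_top).ne]
  refine iSup_congr fun n => ?_
  rw [Equiv.apply_symm_apply, runVal_eq_toReal_approx]
  simp

end Sampler

/-- every probabilistic recursive function is computable by a
probabilistic Turing machine, modulo the fixed bijection between ℕ and Σ*:
PR ⊆ PC. -/
theorem PR_subset_PC (f : (Fin 1 → ℕ) → ℕ → ℝ) (hf : PR f) : PCfun f := by
  obtain ⟨S, hS⟩ := Sampler.exists_samples hf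
  exact Sampler.PCfun_of_samples hS
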